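/- arXiv:2502.03562 — 12 statements merged into one kernel-verified Lean document; each statement's English description precedes it below -/
import Mathlib

section
/- Let p be a prime. Fix integers n ≥ 2, 1 ≤ r ≤ n−1, and K_0, K_1, …, K_r ∈ ℤ_{≥0} with K_0 ≥ K_1 + K_2 + ⋯ + K_r. Then 𝒜_p(K_0, K_1, …, K_r) = Σ_{k_1=0}^{K_1} ⋯ Σ_{k_r=0}^{K_r} A(p^L, p^{K_2+k_1−k_2}, p^{K_3+k_2−k_3}, …, p^{K_r+k_{r−1}−k_r}, p^{k_r}, 1, …, 1), where L = K_0 + K_1 − 2k_1 − k_2 − ⋯ − k_r and the displayed prime-power entries occupy the first r+1 coordinates of the (n−1)-tuple. -/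
/-- The tuple `(m, 1, …, 1)` of length `n - 1`. -/
def E (n m : ℕ) : Fin (n - 1) → ℕ := fun i => if i.val = 0 then m else 1

/-- The Hecke relation satisfied by the Fourier coefficients `A` of a Hecke–Maass form
for `SL(n, ℤ)`:  for all positive integers `m, m₁, …, m_{n-1}`,
`A(m,1,…,1)·A(m₁,…,m_{n-1}) = Σ A(m₁cₙ/c₁, m₂c₁/c₂, …, m_{n-1}c_{n-2}/c_{n-1})`,
the sum over tuples `(c₁,…,cₙ)` of positive integers with `c₁⋯cₙ = m` and `cᵢ ∣ mᵢ`
for `1 ≤ i ≤ n-1`.  (Here the tuple `(c₁,…,c_{n-1})` is parametrized by divisors of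
the `mᵢ` whose product divides `m`, and `cₙ = m / (c₁⋯c_{n-1})`.) -/
def HeckeRel (n : ℕ) (A : (Fin (n - 1) → ℕ) → ℂ) : Prop :=
  ∀ m : ℕ, 0 < m → ∀ M : Fin (n - 1) → ℕ, (∀ i, 0 < M i) →
    A (E n m) * A M =
      ∑ c ∈ Finset.filter (fun c : Fin (n - 1) → ℕ => (∏ i, c i) ∣ m)
          (Fintype.piFinset fun i => (M i).divisors),
        A (fun i => M i *
            (if i.val = 0 then m / ∏ j, c j else c ⟨i.val - 1, by have := i.isLt; omega⟩)
            / c i)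

/-- The tuple `(p^{K₁}, …, p^{K_r}, 1, …, 1)` of length `n - 1`, with the prime powers
in the first `r` coordinates (here `K j` plays the role of `K_j`). -/
def pcoef (n r p : ℕ) (K : ℕ → ℕ) : Fin (n - 1) → ℕ :=
  fun i => if i.val < r then p ^ K (i.val + 1) else 1

/-- The tuple
`(p^L, p^{K₂+k₁-k₂}, p^{K₃+k₂-k₃}, …, p^{K_r+k_{r-1}-k_r}, p^{k_r}, 1, …, 1)`
of length `n - 1`, where `L = K₀ + K₁ - 2k₁ - k₂ - ⋯ - k_r`, appearing in Lemma 2.2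
(here `k ⟨t-1,_⟩` plays the role of `k_t`, and `K j` of `K_j`). -/
def tup (n r p : ℕ) (hr : 0 < r) (K : ℕ → ℕ) (k : Fin r → ℕ) : Fin (n - 1) → ℕ :=
  fun i =>
    if i.val = 0 then p ^ (K 0 + K 1 - (k ⟨0, hr⟩ + ∑ j, k j))
    else if h : i.val < r then
      p ^ (K (i.val + 1) + k ⟨i.val - 1, by omega⟩ - k ⟨i.val, h⟩)
    else if i.val = r then p ^ k ⟨r - 1, by omega⟩
    else 1

theorem aux_sum (N r : ℕ) (h : r ≤ N) (k : Fin r → ℕ) :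
    (∑ i : Fin N, if h : i.val < r then k ⟨i.val, h⟩ else 0) = ∑ j, k j := by
  obtain ⟨d, rfl⟩ := Nat.exists_eq_add_of_le h
  rw [Fin.sum_univ_add]
  simp

theorem aux_prod (N r p : ℕ) (h : r ≤ N) (k : Fin r → ℕ) :
    (∏ i : Fin N, if h : i.val < r then p ^ k ⟨i.val, h⟩ else 1) = p ^ ∑ j, k j := by
  rw [← aux_sum N r h k, ← Finset.prod_pow_eq_pow_sum]
  refine Finset.prod_congr rfl fun i _ => ?_
  split_ifs <;> simp

/-- Lemma 2.2:  Let `p` be a prime.  Fix integers `n ≥ 2`, `1 ≤ r ≤ n-1`, and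
`K₀, K₁, …, K_r ∈ ℤ_{≥0}` with `K₀ ≥ K₁ + ⋯ + K_r`.  Then
`𝒜_p(K₀,…,K_r) = Σ_{k₁=0}^{K₁} ⋯ Σ_{k_r=0}^{K_r} A(p^L, p^{K₂+k₁-k₂}, …,
p^{K_r+k_{r-1}-k_r}, p^{k_r}, 1, …, 1)` with `L = K₀ + K₁ - 2k₁ - k₂ - ⋯ - k_r`,
where `𝒜_p(K₀,…,K_r) = A(p^{K₀},1,…,1)·A(p^{K₁},…,p^{K_r},1,…,1)`. -/
theorem statement0 (n : ℕ) (hn : 2 ≤ n) (A : (Fin (n - 1) → ℕ) → ℂ)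
    (hA1 : A (fun _ => 1) = 1) (hA : HeckeRel n A)
    (p : ℕ) (hp : p.Prime)
    (r : ℕ) (hr : 1 ≤ r) (hrn : r ≤ n - 1)
    (K : ℕ → ℕ) (hK : ∑ i ∈ Finset.Icc 1 r, K i ≤ K 0) :
    A (E n (p ^ K 0)) * A (pcoef n r p K) =
      ∑ k ∈ Fintype.piFinset (fun t : Fin r => Finset.range (K (t.val + 1) + 1)),
        A (tup n r p hr K k) := by
  have hp0 : 0 < p := hp.pos
  have hKs : ∑ j : Fin r, K (j.val + 1) ≤ K 0 := by
    refine le_trans (le_of_eq ?_) hK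
    rw [← Finset.sum_range (fun j => K (j + 1)), Finset.range_eq_Ico,
      Finset.sum_Ico_add' K 0 r 1]
    rfl
  have hle : ∀ k ∈ Fintype.piFinset (fun t : Fin r => Finset.range (K (t.val + 1) + 1)),
      ∀ t, k t ≤ K (t.val + 1) := by
    intro k hk t
    have := Fintype.mem_piFinset.1 hk t
    rw [Finset.mem_range] at this
    omega
  have hsum : ∀ k ∈ Fintype.piFinset (fun t : Fin r => Finset.range (K (t.val + 1) + 1)),
      ∑ j, k j ≤ K 0 := fun k hk =>
    (Finset.sum_le_sum fun j _ => hle k hk j).trans hKs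
  rw [hA _ (pow_pos hp0 _) (pcoef n r p K)
    (by intro i; unfold pcoef; split_ifs <;> positivity)]
  symm
  refine Finset.sum_bij
    (fun k _ => fun i : Fin (n - 1) => if h : i.val < r then p ^ k ⟨i.val, h⟩ else 1)
    ?_ ?_ ?_ ?_
  · intro k hk
    rw [Finset.mem_filter, Fintype.mem_piFinset, aux_prod _ _ _ hrn]
    refine ⟨fun i => ?_, pow_dvd_pow _ (hsum k hk)⟩
    unfold pcoef
    by_cases h : i.val < r
    · simp only [h, dif_pos, if_pos]
      exact (Nat.mem_divisors_prime_pow hp _).2 ⟨_, hle k hk ⟨i.val, h⟩, rfl⟩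
    · simp [h]
  · intro k hk l hl hkl
    funext t
    have := congrFun hkl ⟨t.val, lt_of_lt_of_le t.isLt hrn⟩
    simp only [t.isLt, dif_pos] at this
    exact Nat.pow_right_injective hp.two_le this
  · intro c hc
    rw [Finset.mem_filter, Fintype.mem_piFinset] at hc
    have hex : ∀ t : Fin r, ∃ j, j ≤ K (t.val + 1) ∧
        c ⟨t.val, lt_of_lt_of_le t.isLt hrn⟩ = p ^ j := by
      intro t
      have := hc.1 ⟨t.val, lt_of_lt_of_le t.isLt hrn⟩
      simp only [pcoef, t.isLt, if_pos] at this
      obtain ⟨j, hj, h⟩ := (Nat.mem_divisors_prime_pow hp _).1 this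
      exact ⟨j, hj, h⟩
    choose k hk1 hk2 using hex
    refine ⟨k, ?_, ?_⟩
    · rw [Fintype.mem_piFinset]
      intro t
      rw [Finset.mem_range]
      have := hk1 t
      omega
    · funext i
      by_cases h : i.val < r
      · simp only [h, dif_pos]
        exact (hk2 ⟨i.val, h⟩).symm
      · have := hc.1 i
        simp only [pcoef, h, if_false, Nat.divisors_one, Finset.mem_singleton] at this
        simp [h, this]
  · intro k hk
    congr 1
    funext i
    rw [aux_prod _ _ _ hrn]
    have hs := hsum k hk
    by_cases h0 : i.val = 0
    · have h1 := hle k hk ⟨0, hr⟩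
      have hr' : i.val < r := by omega
      have hi : (⟨i.val, hr'⟩ : Fin r) = ⟨0, hr⟩ := Fin.ext h0
      simp only [tup, pcoef, hr', if_pos, dif_pos, hi, h0]
      simp only [Nat.zero_add] at h1 ⊢
      have hr0 : 0 < r := hr
      simp only [hr0, if_true, dite_true]
      rw [Nat.pow_div hs hp0, ← pow_add, Nat.pow_div (by omega) hp0]
      congr 1
      omega
    · by_cases h : i.val < r
      · have h1 := hle k hk ⟨i.val, h⟩
        have h2 : i.val - 1 < r := by omega
        simp only [tup, pcoef, h, h0, h2, if_pos, dif_pos, if_false]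
        simp only at h1
        rw [← pow_add, Nat.pow_div (by omega) hp0]
      · by_cases h3 : i.val = r
        · have h2 : r - 1 < r := by omega
          have h4 : r ≠ 0 := by omega
          simp [tup, pcoef, h3, h2, h4]
        · have h2 : ¬ (i.val - 1 < r) := by omega
          simp [tup, pcoef, h, h0, h2, h3]
end

section
/- Let p be a prime. Fix integers n ≥ 2, 1 ≤ r ≤ n−1, and K_0, K_1, …, K_r ∈ ℤ_{≥0} with K_0 ≥ K_1 + K_2 + ⋯ + K_r and K_1 ≥ 1. Then 𝒜_p(K_0, K_1, K_2, …, K_r) − 𝒜_p(K_0+1, K_1−1, K_2, …, K_r) = Σ_{k_2=0}^{K_2} ⋯ Σ_{k_r=0}^{K_r} A(p^{K_0−K_1−k_2−⋯−k_r}, p^{K_2+K_1−k_2}, p^{K_3+k_2−k_3}, …, p^{K_r+k_{r−1}−k_r}, p^{k_r}, 1, …, 1), where the entry p^{k_r} occurs in the (r+1)-st coordinate of the (n−1)-tuple. -/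
/-- Extension by zero of an exponent vector. -/
def extz (r : ℕ) (k : Fin r → ℕ) : ℕ → ℕ := fun i => if h : i < r then k ⟨i, h⟩ else 0

lemma extz_sum (N r : ℕ) (h : r ≤ N) (k : Fin r → ℕ) :
    ∑ i : Fin N, extz r k i.val = ∑ i, k i := by
  rw [Fin.sum_univ_eq_sum_range (extz r k) N]
  have h2 : ∑ i : Fin r, k i = ∑ i : Fin r, extz r k i.val := by
    apply Finset.sum_congr rfl
    intro i _
    simp [extz]
  rw [h2, Fin.sum_univ_eq_sum_range (extz r k) r]
  symm
  apply Finset.sum_subset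
  · intro x hx
    simp only [Finset.mem_range] at *
    omega
  · intro x _ hx
    simp only [Finset.mem_range] at hx
    simp [extz, hx]

lemma hecke_expand (n : ℕ) (A : (Fin (n - 1) → ℕ) → ℂ) (hA : HeckeRel n A)
    (p : ℕ) (hp : p.Prime) (r : ℕ) (hr : 1 ≤ r) (hrn : r ≤ n - 1)
    (K : ℕ → ℕ) (hK : ∑ i ∈ Finset.Icc 1 r, K i ≤ K 0) :
    A (E n (p ^ K 0)) * A (pcoef n r p K) =
      ∑ k ∈ Fintype.piFinset (fun t : Fin r => Finset.range (K (t.val + 1) + 1)),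
        A (tup n r p hr K k) := by
  have hp0 : 0 < p := hp.pos
  rw [hA _ (pow_pos hp0 _) _ (by
    intro i
    unfold pcoef
    split_ifs
    · exact pow_pos hp0 _
    · exact one_pos)]
  have hprod : ∀ k : Fin r → ℕ, ∏ i : Fin (n - 1), p ^ extz r k i.val = p ^ ∑ i, k i := by
    intro k
    rw [Finset.prod_pow_eq_pow_sum, extz_sum _ _ hrn]
  have hle : ∀ k ∈ Fintype.piFinset (fun t : Fin r => Finset.range (K (t.val + 1) + 1)),
      ∑ i, k i ≤ K 0 := by
    intro k hk
    refine le_trans ?_ hK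
    have : ∑ i ∈ Finset.Icc 1 r, K i = ∑ i : Fin r, K (i.val + 1) := by
      rw [Fin.sum_univ_eq_sum_range (fun i => K (i + 1)) r, Finset.range_eq_Ico,
        Finset.sum_Ico_add' K 0 r 1]
      rfl
    rw [this]
    apply Finset.sum_le_sum
    intro i _
    have := Fintype.mem_piFinset.1 hk i
    simp only [Finset.mem_range] at this
    omega
  symm
  refine Finset.sum_bij (fun k _ => fun i => p ^ extz r k i.val) ?_ ?_ ?_ ?_
  · intro k hk
    rw [Finset.mem_filter, hprod]
    refine ⟨?_, pow_dvd_pow _ (hle k hk)⟩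
    rw [Fintype.mem_piFinset]
    intro i
    unfold pcoef extz
    by_cases h : i.val < r
    · have := Fintype.mem_piFinset.1 hk ⟨i.val, h⟩
      simp only [Finset.mem_range] at this
      simp only [h, if_true, dite_true, Nat.mem_divisors]
      exact ⟨pow_dvd_pow _ (by omega), (pow_pos hp0 _).ne'⟩
    · simp [h]
  · intro k _ k' _ h
    funext t
    have := congrFun h ⟨t.val, by omega⟩
    have := Nat.pow_right_injective hp.two_le this
    simpa [extz] using this
  · intro c hc
    rw [Finset.mem_filter, Fintype.mem_piFinset] at hc
    have h1 := hc.1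
    have : ∀ t : Fin r, ∃ e, e ≤ K (t.val + 1) ∧ c ⟨t.val, by omega⟩ = p ^ e := by
      intro t
      have := h1 ⟨t.val, by omega⟩
      simp only [pcoef, t.isLt, if_true, Nat.mem_divisors] at this
      obtain ⟨e, he, h⟩ := (Nat.dvd_prime_pow hp).1 this.1
      exact ⟨e, he, h⟩
    choose k hk1 hk2 using this
    refine ⟨k, ?_, ?_⟩
    · rw [Fintype.mem_piFinset]
      intro t
      have := hk1 t
      simp only [Finset.mem_range]
      omega
    · funext i
      by_cases h : i.val < r
      · have := hk2 ⟨i.val, h⟩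
        simp only [extz, h, dite_true]
        exact this.symm
      · have := h1 i
        simp only [pcoef, h, if_false, Nat.divisors_one, Finset.mem_singleton] at this
        simp [extz, h, this]
  · intro k hk
    congr 1
    funext i
    rw [hprod, Nat.pow_div (hle k hk) hp0]
    have hkk := Fintype.mem_piFinset.1 hk
    simp only [Finset.mem_range] at hkk
    by_cases h0 : i.val = 0
    · have hh : k ⟨0, hr⟩ < K 1 + 1 := hkk ⟨0, hr⟩
      have hr0 : 0 < r := hr
      have := hle k hk
      simp only [tup, pcoef, extz, h0, if_true, hr0, dite_true, zero_add]
      rw [← pow_add, Nat.pow_div (by omega) hp0]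
      congr 1
      omega
    · by_cases h : i.val < r
      · have hh := hkk ⟨i.val, h⟩
        have h' : i.val - 1 < r := by omega
        simp only at hh
        simp only [tup, pcoef, extz, h0, if_true, if_false, h, h', dite_true]
        rw [← pow_add, Nat.pow_div (by omega) hp0]
      · by_cases h2 : i.val = r
        · have h' : r - 1 < r := by omega
          have h3 : r ≠ 0 := by omega
          simp [tup, pcoef, extz, h2, h', h3]
        · have h' : ¬ i.val - 1 < r := by omega
          simp [tup, pcoef, extz, h0, h, h2, h']

/-- Equation (2.4) ("FirstStep"):  Let `p` be a prime.  Fix integers `n ≥ 2`,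
`1 ≤ r ≤ n-1`, and `K₀, K₁, …, K_r ∈ ℤ_{≥0}` with `K₀ ≥ K₁ + ⋯ + K_r` and `K₁ ≥ 1`.
Then `𝒜_p(K₀,K₁,…,K_r) - 𝒜_p(K₀+1,K₁-1,…,K_r)
= Σ_{k₂=0}^{K₂} ⋯ Σ_{k_r=0}^{K_r} A(p^{K₀-K₁-k₂-⋯-k_r}, p^{K₂+K₁-k₂},
p^{K₃+k₂-k₃}, …, p^{K_r+k_{r-1}-k_r}, p^{k_r}, 1, …, 1)`,
where `p^{k_r}` occurs in the `(r+1)`-st coordinate.  (The summand here is `tup`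
evaluated at `k₁ = K₁`, `k_{t} = κ_{t}` for `2 ≤ t ≤ r`, which agrees with the
displayed tuple.) -/
theorem statement1 (n : ℕ) (hn : 2 ≤ n) (A : (Fin (n - 1) → ℕ) → ℂ)
    (hA1 : A (fun _ => 1) = 1) (hA : HeckeRel n A)
    (p : ℕ) (hp : p.Prime)
    (r : ℕ) (hr : 1 ≤ r) (hrn : r ≤ n - 1)
    (K : ℕ → ℕ) (hK : ∑ i ∈ Finset.Icc 1 r, K i ≤ K 0) (hK1 : 1 ≤ K 1) :
    A (E n (p ^ K 0)) * A (pcoef n r p K)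
      - A (E n (p ^ (K 0 + 1))) * A (pcoef n r p (Function.update K 1 (K 1 - 1))) =
      ∑ κ ∈ Fintype.piFinset (fun t : Fin (r - 1) => Finset.range (K (t.val + 2) + 1)),
        A (tup n r p hr K
            (fun t => if ht : t.val = 0 then K 1
              else κ ⟨t.val - 1, by have := t.isLt; omega⟩)) := by
  have hr0 : 0 < r := hr
  set K' : ℕ → ℕ := Function.update (Function.update K 1 (K 1 - 1)) 0 (K 0 + 1) with hK'
  have hK'0 : K' 0 = K 0 + 1 := by simp [hK']
  have hK'1 : K' 1 = K 1 - 1 := by simp [hK']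
  have hK's : ∀ j, 2 ≤ j → K' j = K j := by
    intro j hj
    simp [hK', Function.update, show j ≠ 0 by omega, show j ≠ 1 by omega]
  have hle : ∀ j, 1 ≤ j → K' j ≤ K j := by
    intro j hj
    rcases Nat.lt_or_ge 1 j with h | h
    · exact (hK's j h).le
    · have : j = 1 := by omega
      subst this
      omega
  have hpc : pcoef n r p (Function.update K 1 (K 1 - 1)) = pcoef n r p K' := by
    funext i
    simp [pcoef, hK', Function.update]
  have htup : ∀ k, tup n r p hr K' k = tup n r p hr K k := by
    intro k
    funext i
    unfold tup
    by_cases h0 : i.val = 0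
    · simp only [h0, if_true]
      congr 2
      omega
    · simp only [h0, if_false]
      rw [hK's (i.val + 1) (by omega)]
  have hS' : ∑ i ∈ Finset.Icc 1 r, K' i ≤ K' 0 := by
    rw [hK'0]
    refine le_trans (Finset.sum_le_sum (fun i hi => hle i (Finset.mem_Icc.1 hi).1)) ?_
    omega
  have e1 := hecke_expand n A hA p hp r hr hrn K hK
  have e2 := hecke_expand n A hA p hp r hr hrn K' hS'
  rw [hpc, ← hK'0, e1, e2]
  simp only [htup]
  rw [← Finset.sum_filter_add_sum_filter_not
    (Fintype.piFinset (fun t : Fin r => Finset.range (K (t.val + 1) + 1)))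
    (fun k => k ⟨0, hr0⟩ = K 1)]
  have hS : Finset.filter (fun k : Fin r → ℕ => ¬ k ⟨0, hr0⟩ = K 1)
      (Fintype.piFinset (fun t : Fin r => Finset.range (K (t.val + 1) + 1))) =
      Fintype.piFinset (fun t : Fin r => Finset.range (K' (t.val + 1) + 1)) := by
    ext k
    simp only [Finset.mem_filter, Fintype.mem_piFinset, Finset.mem_range]
    constructor
    · rintro ⟨h1, h2⟩ t
      have ht := h1 t
      rcases Nat.eq_zero_or_pos t.val with h | h
      · have : t = ⟨0, hr0⟩ := Fin.ext h
        subst this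
        simp only [zero_add] at ht ⊢
        omega
      · rw [hK's _ (by omega)]
        exact ht
    · intro h
      refine ⟨fun t => ?_, ?_⟩
      · have := h t
        have := hle (t.val + 1) (by omega)
        omega
      · have := h ⟨0, hr0⟩
        simp only [zero_add] at this
        omega
  rw [hS, add_sub_cancel_right]
  refine Finset.sum_bij' (fun k _ => fun t : Fin (r - 1) => k ⟨t.val + 1, by omega⟩)
    (fun κ _ => fun t : Fin r => if ht : t.val = 0 then K 1
              else κ ⟨t.val - 1, by have := t.isLt; omega⟩) ?_ ?_ ?_ ?_ ?_
  · intro k hk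
    simp only [Finset.mem_filter, Fintype.mem_piFinset, Finset.mem_range] at hk ⊢
    intro t
    exact hk.1 ⟨t.val + 1, by omega⟩
  · intro κ hκ
    simp only [Finset.mem_filter, Fintype.mem_piFinset, Finset.mem_range] at hκ ⊢
    refine ⟨fun t => ?_, by simp⟩
    by_cases h : t.val = 0
    · simp [h]
    · have := hκ ⟨t.val - 1, by omega⟩
      simp only [h, dite_false]
      rw [show t.val + 1 = t.val - 1 + 2 by omega]
      exact this
  · intro k hk
    simp only [Finset.mem_filter] at hk
    funext t
    by_cases h : t.val = 0
    · have : t = ⟨0, hr0⟩ := Fin.ext h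
      subst this
      simp [hk.2]
    · simp only [h, dite_false]
      congr 1
      apply Fin.ext
      simp only
      omega
  · intro κ hκ
    funext t
    simp
  · intro k hk
    simp only [Finset.mem_filter] at hk
    congr 2
    funext t
    by_cases h : t.val = 0
    · have : t = ⟨0, hr0⟩ := Fin.ext h
      subst this
      simp [hk.2]
    · simp only [h, dite_false]
      congr 1
      apply Fin.ext
      simp only
      omega
end

section
/- Let p be a prime and let K_1, K_2, …, K_{n−1} ∈ ℤ_{≥0}. Then A(p^{K_1}, p^{K_2}, …, p^{K_{n−1}}) lies in the subring of ℂ generated by the set {A(p^k, 1, …, 1) : k ∈ ℤ_{≥0}} (equivalently, it is an integer polynomial in the values A(p^k,1,…,1); these values are eigenvalues of the Hecke operators T_{p^k}, so A(p^{K_1},…,p^{K_{n−1}}) is an eigenvalue of an element of the Hecke algebra ℋ_p). -/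
/-- The exponents of a term of the Hecke sum. -/
def expo (S R : ℕ) (k d : ℕ → ℕ) : ℕ → ℕ := fun i =>
  k (i + 1) + (if i = 0 then S - ∑ j ∈ Finset.range R, d j else d (i - 1)) - d i

theorem shift_sum (R : ℕ) (f : ℕ → ℕ) (hR : f R = 0) :
    ∑ j ∈ Finset.range R, j * f j = ∑ j ∈ Finset.range R, (j + 1) * f (j + 1) := by
  have h1 := Finset.sum_range_succ (fun j => j * f j) R
  have h2 := Finset.sum_range_succ' (fun j => j * f j) R
  simp only [hR] at h1
  simp at h1 h2
  omega

theorem weight_expo (S R : ℕ) (k d : ℕ → ℕ) (hd : ∀ j, d j ≤ k (j + 1))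
    (hk : ∀ j, R ≤ j → k j = 0) (hR : 1 ≤ R) :
    ∑ j ∈ Finset.range R, j * expo S R k d j + ∑ j ∈ Finset.range R, k (j + 1)
      = ∑ j ∈ Finset.range R, j * k j + ∑ j ∈ Finset.range R, d j := by
  have a1 := shift_sum R k (hk R le_rfl)
  have hdR : d (R - 1) = 0 := by
    have h1 := hd (R - 1)
    have h2 := hk (R - 1 + 1) (by omega)
    omega
  have a2 := shift_sum R (fun j => d (j - 1)) hdR
  simp only [Nat.add_sub_cancel] at a2
  have a3 : ∑ j ∈ Finset.range R, j * expo S R k d j + ∑ j ∈ Finset.range R, j * d j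
      = ∑ j ∈ Finset.range R, j * k (j + 1) + ∑ j ∈ Finset.range R, j * d (j - 1) := by
    rw [← Finset.sum_add_distrib, ← Finset.sum_add_distrib]
    refine Finset.sum_congr rfl fun j _ => ?_
    rcases Nat.eq_zero_or_pos j with rfl | hj
    · simp
    · rw [← mul_add, ← mul_add]
      congr 1
      have := hd j
      simp only [expo, if_neg hj.ne']
      omega
  simp only [add_mul, one_mul, Finset.sum_add_distrib] at a1 a2
  omega

theorem term_eq (n p : ℕ) (hp : p.Prime) (S : ℕ) (k d : ℕ → ℕ) (hd : ∀ j, d j ≤ k (j + 1))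
    (hS : ∑ j ∈ Finset.range (n - 1), d j ≤ S) (i : Fin (n - 1)) :
    p ^ k (i.val + 1) * (if i.val = 0 then p ^ S / ∏ j : Fin (n - 1), p ^ d j.val
      else p ^ d (i.val - 1)) / p ^ d i.val = p ^ expo S (n - 1) k d i.val := by
  rw [Finset.prod_pow_eq_pow_sum, Fin.sum_univ_eq_sum_range, Nat.pow_div hS hp.pos]
  have := hd i.val
  unfold expo
  split_ifs with h
  · rw [← pow_add, Nat.pow_div (by omega) hp.pos]
  · rw [← pow_add, Nat.pow_div (by omega) hp.pos]

theorem main_ind (n : ℕ) (hn : 2 ≤ n) (A : (Fin (n - 1) → ℕ) → ℂ) (hA : HeckeRel n A)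
    (p : ℕ) (hp : p.Prime) (N : ℕ) : ∀ k : ℕ → ℕ, (∀ j, n - 1 ≤ j → k j = 0) →
    ∑ j ∈ Finset.range (n - 1), j * k j = N →
    A (fun i => p ^ k i.val) ∈
      Subring.closure {z : ℂ | ∃ k : ℕ, z = A (E n (p ^ k))} := by
  induction N using Nat.strong_induction_on with
  | _ N ih =>
  intro k hk hN
  rcases Nat.eq_zero_or_pos N with h0 | hpos
  · apply Subring.subset_closure
    refine ⟨k 0, ?_⟩
    congr 1
    funext i
    unfold E
    split_ifs with h
    · rw [h]
    · rw [h0, Finset.sum_eq_zero_iff] at hN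
      have := hN i.val (Finset.mem_range.2 i.isLt)
      have : k i.val = 0 := by
        rcases Nat.mul_eq_zero.1 this with h' | h'
        · exact absurd h' h
        · exact h'
      simp [this]
  have hR : 1 ≤ (n - 1) := by omega
  set S := ∑ j ∈ Finset.range (n - 1), k j with hS
  have hSk : S = ∑ j ∈ Finset.range (n - 1), k (j + 1) + k 0 := by
    have h1 := Finset.sum_range_succ k (n - 1)
    have h2 := Finset.sum_range_succ' k (n - 1)
    have := hk (n - 1) le_rfl
    omega
  have hshift := shift_sum (n - 1) k (hk (n - 1) le_rfl)
  simp only [add_mul, one_mul, Finset.sum_add_distrib] at hshift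
  have hpos' : 0 < ∑ j ∈ Finset.range (n - 1), k (j + 1) := by
    rcases Nat.eq_zero_or_pos (∑ j ∈ Finset.range (n - 1), k (j + 1)) with h | h
    · have h' := Finset.sum_eq_zero_iff.1 h
      have : ∑ j ∈ Finset.range (n - 1), j * k (j + 1) = 0 :=
        Finset.sum_eq_zero fun j hj => by rw [h' j hj, mul_zero]
      omega
    · exact h
  have hA' : A (fun i => p ^ k (i.val + 1)) ∈
      Subring.closure {z : ℂ | ∃ k : ℕ, z = A (E n (p ^ k))} :=
    ih (∑ j ∈ Finset.range (n - 1), j * k (j + 1)) (by omega) (fun j => k (j + 1))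
      (fun j hj => hk _ (by omega)) rfl
  have hE : A (E n (p ^ S)) ∈
      Subring.closure {z : ℂ | ∃ k : ℕ, z = A (E n (p ^ k))} :=
    Subring.subset_closure ⟨S, rfl⟩
  have hrel := hA (p ^ S) (pow_pos hp.pos _) (fun i => p ^ k (i.val + 1))
    (fun i => pow_pos hp.pos _)
  have hmem : (fun i : Fin (n - 1) => p ^ k (i.val + 1)) ∈
      Finset.filter (fun c : Fin (n - 1) → ℕ => (∏ i, c i) ∣ p ^ S)
          (Fintype.piFinset fun i : Fin (n - 1) => (p ^ k (i.val + 1)).divisors) := by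
    rw [Finset.mem_filter, Fintype.mem_piFinset]
    refine ⟨fun i => Nat.mem_divisors_self _ (pow_pos hp.pos _).ne', ?_⟩
    rw [Finset.prod_pow_eq_pow_sum, Fin.sum_univ_eq_sum_range (fun j => k (j + 1))]
    exact pow_dvd_pow _ (by omega)
  rw [← Finset.add_sum_erase _ _ hmem] at hrel
  have hmain : (fun i : Fin (n - 1) => p ^ k (i.val + 1) *
      (if i.val = 0 then p ^ S / ∏ j : Fin (n - 1), p ^ k (j.val + 1)
      else p ^ k (i.val - 1 + 1)) / p ^ k (i.val + 1)) = fun i => p ^ k i.val := by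
    funext i
    rw [term_eq n p hp S k (fun j => k (j + 1)) (fun j => le_rfl) (by omega) i]
    congr 1
    unfold expo
    split_ifs with h
    · rw [h]; dsimp only; simp only [zero_add]; omega
    · have : i.val - 1 + 1 = i.val := by omega
      dsimp only
      rw [this]; omega
  rw [hmain] at hrel
  rw [← sub_eq_iff_eq_add] at hrel
  rw [← hrel]
  refine Subring.sub_mem _ (Subring.mul_mem _ hE hA') (Subring.sum_mem _ fun c hc => ?_)
  rw [Finset.mem_erase, Finset.mem_filter, Fintype.mem_piFinset] at hc
  obtain ⟨hne, hdiv, -⟩ := hc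
  have hex : ∀ i : Fin (n - 1), ∃ d, d ≤ k (i.val + 1) ∧ c i = p ^ d := fun i =>
    (Nat.dvd_prime_pow hp).1 (Nat.dvd_of_mem_divisors (hdiv i))
  choose d₀ hd₀ hcd using hex
  obtain ⟨d, hdef⟩ : ∃ d : ℕ → ℕ, d = fun j => if h : j < n - 1 then d₀ ⟨j, h⟩ else 0 :=
    ⟨_, rfl⟩
  have hd : ∀ j, d j ≤ k (j + 1) := by
    intro j
    rw [hdef]
    dsimp only
    split_ifs with h
    · exact hd₀ ⟨j, h⟩
    · exact Nat.zero_le _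
  have hc : c = fun i => p ^ d i.val := by
    funext i
    rw [hcd i, hdef]
    simp
  subst hc
  have hlt : ∑ j ∈ Finset.range (n - 1), d j < ∑ j ∈ Finset.range (n - 1), k (j + 1) := by
    apply Finset.sum_lt_sum (fun j _ => hd j)
    by_contra! hcon
    apply hne
    funext i
    have := hcon i.val (Finset.mem_range.2 i.isLt)
    have h2 := hd i.val
    rw [le_antisymm h2 this]
  have hw := weight_expo S (n - 1) k d hd hk hR
  have hterm := fun i => term_eq n p hp S k d hd (by omega) i
  simp only [hterm]
  refine ih _ ?_ (expo S (n - 1) k d) ?_ rfl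
  · omega
  · intro j hj
    have h1 := hk (j + 1) (by omega)
    have h2 := hd (j - 1)
    have h3 := hk (j - 1 + 1) (by omega)
    unfold expo
    rw [if_neg (by omega)]
    omega

theorem statement3 (n : ℕ) (hn : 2 ≤ n) (A : (Fin (n - 1) → ℕ) → ℂ)
    (hA1 : A (fun _ => 1) = 1) (hA : HeckeRel n A)
    (p : ℕ) (hp : p.Prime) (K : Fin (n - 1) → ℕ) :
    A (fun i => p ^ K i) ∈
      Subring.closure {z : ℂ | ∃ k : ℕ, z = A (E n (p ^ k))} := by
  have h := main_ind n hn A hA p hp _ (fun j => if h : j < n - 1 then K ⟨j, h⟩ else 0)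
    (fun j hj => by simp [hj]) rfl
  simpa using h
end

section
/- Let p be a prime, let 1 ≤ r ≤ n−1, and let K_1, …, K_r ∈ ℤ_{≥0}. Then A(p^{K_1}, …, p^{K_r}, 1, …, 1) (with p^{K_1},…,p^{K_r} in the first r coordinates) lies in the subring of ℂ generated by the set {A(p^k, 1, …, 1) : k ∈ ℤ_{≥0}}. -/
lemma aux_tele (K g K' : ℕ → ℕ) (hg : ∀ i, g i ≤ K (i + 1))
    (hK' : ∀ i, K' (i + 1) = K (i + 2) + g i - g (i + 1)) (N : ℕ) :
    ∑ i ∈ Finset.range (N + 1), i * K' i + N * g N =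
      ∑ i ∈ Finset.range (N + 1), i * K (i + 1) + ∑ i ∈ Finset.range N, g i := by
  induction N with
  | zero => simp
  | succ N ih =>
    rw [Finset.sum_range_succ, Finset.sum_range_succ (fun i => i * K (i + 1)),
      Finset.sum_range_succ g]
    have h1 : K' (N + 1) + g (N + 1) = K (N + 2) + g N := by
      have := hK' N
      have := hg (N + 1)
      simp only [add_assoc, Nat.reduceAdd] at this
      omega
    have h2 : (N + 1) * K' (N + 1) + (N + 1) * g (N + 1)
        = (N + 1) * K (N + 2) + (N * g N + g N) := by
      rw [← mul_add, h1]; ring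
    have h3 : K (N + 1 + 1) = K (N + 2) := rfl
    rw [h3]
    omega

lemma aux_lt (K g K' : ℕ → ℕ) (N : ℕ) (hN : 1 ≤ N) (h0 : ∀ i, N ≤ i → K i = 0)
    (hg : ∀ i, g i ≤ K (i + 1))
    (hK' : ∀ i, K' (i + 1) = K (i + 2) + g i - g (i + 1))
    (hne : ∃ i, g i ≠ K (i + 1)) :
    ∑ i ∈ Finset.range N, i * K' i < ∑ i ∈ Finset.range N, i * K i := by
  obtain ⟨N, rfl⟩ : ∃ k, N = k + 1 := ⟨N - 1, by omega⟩
  have h := aux_tele K g K' hg hK' N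
  have hgN : g N = 0 := by have := hg N; rw [h0 _ le_rfl] at this; omega
  have hlt : ∑ i ∈ Finset.range N, g i < ∑ i ∈ Finset.range N, K (i + 1) := by
    obtain ⟨i, hi⟩ := hne
    apply Finset.sum_lt_sum (fun i _ => hg i)
    refine ⟨i, ?_, lt_of_le_of_ne (hg i) hi⟩
    by_contra hc
    simp only [Finset.mem_range, not_lt] at hc
    have h1 := hg i
    rw [h0 (i + 1) (by omega)] at h1 hi
    omega
  rw [hgN, Finset.sum_range_succ (fun i => i * K (i + 1)), h0 _ le_rfl] at h
  rw [Finset.sum_range_succ' (fun i => i * K i)]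
  simp only [add_mul, one_mul, Finset.sum_add_distrib, zero_mul]
  omega

lemma aux_main (n : ℕ) (hn : 2 ≤ n) (A : (Fin (n - 1) → ℕ) → ℂ)
    (hA : HeckeRel n A) (p : ℕ) (hp : p.Prime) (d : ℕ) :
    ∀ K : ℕ → ℕ, (∀ i, n - 1 ≤ i → K i = 0) →
      ∑ i ∈ Finset.range (n - 1), i * K i = d →
      A (fun i => p ^ K i.val) ∈ Subring.closure {z : ℂ | ∃ k : ℕ, z = A (E n (p ^ k))} := by
  induction d using Nat.strong_induction_on with
  | _ d ih =>
  intro K h0 hd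
  by_cases hz : ∀ i, K (i + 1) = 0
  · apply Subring.subset_closure
    refine ⟨K 0, ?_⟩
    congr 1
    funext i
    unfold E
    rcases Nat.eq_zero_or_pos i.val with h | h
    · simp [h]
    · have := hz (i.val - 1)
      rw [Nat.sub_add_cancel h] at this
      simp [this, h.ne']
  have hpp : ∀ k, 0 < p ^ k := fun k => pow_pos hp.pos k
  set L := ∑ i ∈ Finset.range (n - 1), K i with hL
  have hsucc : ∑ i ∈ Finset.range (n - 1), K (i + 1) ≤ L := by
    obtain ⟨N, hN⟩ : ∃ k, n - 1 = k + 1 := ⟨n - 2, by omega⟩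
    rw [hL, hN, Finset.sum_range_succ, Finset.sum_range_succ' K, h0 (N + 1) (by omega)]
    omega
  have hrel := hA (p ^ L) (hpp _) (fun i => p ^ K (i.val + 1)) (fun i => hpp _)
  have hprod : ∀ g : ℕ → ℕ, ∏ j : Fin (n - 1), p ^ g j.val
      = p ^ ∑ i ∈ Finset.range (n - 1), g i := by
    intro g
    rw [Finset.prod_pow_eq_pow_sum, Finset.sum_range]
  rw [← Finset.add_sum_erase _ _ (a := fun i : Fin (n - 1) => p ^ K (i.val + 1)) (by
    simp only [Finset.mem_filter, Fintype.mem_piFinset, Nat.mem_divisors]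
    refine ⟨fun i => ⟨dvd_rfl, (hpp _).ne'⟩, ?_⟩
    rw [hprod (fun i => K (i + 1))]
    exact pow_dvd_pow _ hsucc)] at hrel
  have hterm : (fun i : Fin (n - 1) => p ^ K (i.val + 1) *
            (if i.val = 0 then p ^ L / ∏ j : Fin (n - 1), p ^ K (j.val + 1)
              else p ^ K (i.val - 1 + 1))
            / p ^ K (i.val + 1)) = fun i => p ^ K i.val := by
    funext i
    rw [Nat.mul_div_cancel_left _ (hpp _), hprod (fun i => K (i + 1))]
    split_ifs with h
    · rw [Nat.pow_div hsucc hp.pos, h]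
      congr 1
      obtain ⟨N, hN⟩ : ∃ k, n - 1 = k + 1 := ⟨n - 2, by omega⟩
      rw [hL, hN, Finset.sum_range_succ (fun i => K (i + 1)), Finset.sum_range_succ' K,
        h0 (N + 1) (by omega)]
      omega
    · congr 2; omega
  rw [hterm] at hrel
  have hrel' := eq_sub_of_add_eq hrel.symm
  rw [hrel']
  refine Subring.sub_mem _ (Subring.mul_mem _ (Subring.subset_closure ⟨L, rfl⟩) ?_)
    (Subring.sum_mem _ ?_)
  · refine ih _ ?_ (fun i => K (i + 1)) (fun i hi => h0 _ (by omega)) rfl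
    rw [← hd]
    push Not at hz
    obtain ⟨j, hj⟩ := hz
    refine aux_lt K (fun _ => 0) (fun i => K (i + 1)) (n - 1) (by omega) h0
      (fun _ => Nat.zero_le _) (fun i => by simp) ⟨j, fun h => hj h.symm⟩
  · intro c hc
    simp only [Finset.mem_erase, Finset.mem_filter, Fintype.mem_piFinset, Nat.mem_divisors,
      Nat.dvd_prime_pow hp] at hc
    obtain ⟨hne, hc, -⟩ := hc
    choose γ hγ hcγ using fun i => (hc i).1
    set g : ℕ → ℕ := fun i => if h : i < n - 1 then γ ⟨i, h⟩ else 0 with hgdef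
    have hcg : ∀ i : Fin (n - 1), c i = p ^ g i.val := by
      intro i
      simp [hgdef, hcγ]
    have hg : ∀ i, g i ≤ K (i + 1) := by
      intro i
      simp only [hgdef]
      split_ifs with h
      · exact hγ ⟨i, h⟩
      · exact Nat.zero_le _
    have hgL : ∑ i ∈ Finset.range (n - 1), g i ≤ L :=
      (Finset.sum_le_sum (fun i _ => hg i)).trans hsucc
    set K' : ℕ → ℕ := fun i => K (i + 1) +
      (if i = 0 then L - ∑ i ∈ Finset.range (n - 1), g i else g (i - 1)) - g i with hK'
    set K'' : ℕ → ℕ := fun i => if i < n - 1 then K' i else 0 with hK''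
    have hlt : ∑ i ∈ Finset.range (n - 1), i * K' i < d := by
      rw [← hd]
      refine aux_lt K g K' (n - 1) (by omega) h0 hg (fun i => by simp [hK']) ?_
      by_contra hcon
      push Not at hcon
      apply hne
      funext i
      rw [hcg, hcon]
    have hsum : ∑ i ∈ Finset.range (n - 1), i * K'' i
        = ∑ i ∈ Finset.range (n - 1), i * K' i := by
      apply Finset.sum_congr rfl
      intro i hi
      simp only [hK'', if_pos (Finset.mem_range.mp hi)]
    have key := ih _ hlt K'' (fun i hi => by simp only [hK'', if_neg (not_lt.mpr hi)]) hsum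
    convert key using 2
    funext i
    simp only [hK'', if_pos i.isLt, hK']
    simp only [hcg]
    rw [hprod g, Nat.pow_div hgL hp.pos]
    have hle := hg i.val
    split_ifs with h
    · rw [← pow_add, Nat.pow_div (by omega) hp.pos]
    · rw [← pow_add, Nat.pow_div (by omega) hp.pos]

/-- Statement (2.3) ("r-Induction"):  Let `p` be a prime, `1 ≤ r ≤ n-1`, and
`K₁, …, K_r ∈ ℤ_{≥0}`.  Then `A(p^{K₁}, …, p^{K_r}, 1, …, 1)` (with the prime powers
in the first `r` coordinates) lies in the subring of `ℂ` generated by the set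
`{A(p^k, 1, …, 1) : k ∈ ℤ_{≥0}}`. -/
theorem statement4 (n : ℕ) (hn : 2 ≤ n) (A : (Fin (n - 1) → ℕ) → ℂ)
    (hA1 : A (fun _ => 1) = 1) (hA : HeckeRel n A)
    (p : ℕ) (hp : p.Prime)
    (r : ℕ) (hr : 1 ≤ r) (hrn : r ≤ n - 1) (K : ℕ → ℕ) :
    A (pcoef n r p K) ∈
      Subring.closure {z : ℂ | ∃ k : ℕ, z = A (E n (p ^ k))} := by
  have key := aux_main n hn A hA p hp _ (fun i => if i < r then K (i + 1) else 0)
    (fun i hi => if_neg (by omega)) rfl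
  convert key using 2
  funext i
  unfold pcoef
  split_ifs <;> simp
end

section
/- Let p be a prime and let m_1, m_2, …, m_{n−1} be positive integers with p ∤ m_1 m_2 ⋯ m_{n−1}. Fix integers 1 ≤ r ≤ n−1 and K_0, K_1, …, K_r ∈ ℤ_{≥0} with K_0 ≥ K_1 + K_2 + ⋯ + K_r. Then A(p^{K_0}, 1, …, 1) · A(p^{K_1} m_1, p^{K_2} m_2, …, p^{K_r} m_r, m_{r+1}, …, m_{n−1}) = Σ_{k_1=0}^{K_1} ⋯ Σ_{k_r=0}^{K_r} A(p^L m_1, p^{K_2+k_1−k_2} m_2, …, p^{K_r+k_{r−1}−k_r} m_r, p^{k_r} m_{r+1}, m_{r+2}, …, m_{n−1}), where L = K_0 + K_1 − 2k_1 − k_2 − ⋯ − k_r. -/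
/-- extension by zero of `k` -/
def kext (r : ℕ) (k : Fin r → ℕ) (i : ℕ) : ℕ := if h : i < r then k ⟨i, h⟩ else 0

theorem kext_lt (r : ℕ) (k : Fin r → ℕ) (i : ℕ) (h : i < r) : kext r k i = k ⟨i, h⟩ := by
  simp [kext, h]

theorem kext_ge (r : ℕ) (k : Fin r → ℕ) (i : ℕ) (h : ¬ i < r) : kext r k i = 0 := by
  simp [kext, h]

theorem kext_prod (N r p : ℕ) (hrN : r ≤ N) (k : Fin r → ℕ) :
    ∏ i : Fin N, p ^ kext r k i.val = p ^ ∑ j, k j := by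
  rw [Finset.prod_pow_eq_pow_sum, Fin.sum_univ_eq_sum_range (kext r k)]
  congr 1
  have h1 : ∑ j, k j = ∑ j : Fin r, kext r k j.val :=
    Finset.sum_congr rfl (fun j _ => (kext_lt r k j.val j.isLt).symm)
  rw [h1, Fin.sum_univ_eq_sum_range (kext r k)]
  symm
  apply Finset.sum_subset
  · intro x hx
    simp only [Finset.mem_range] at *
    omega
  · intro x _ hx
    simp only [Finset.mem_range] at hx
    exact kext_ge r k x hx

theorem div_aux (p a m b c : ℕ) (hp : 0 < p) (h : c ≤ a + b) :
    p ^ a * m * p ^ b / p ^ c = p ^ (a + b - c) * m := by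
  have : p ^ a * m * p ^ b = p ^ c * (p ^ (a + b - c) * m) := by
    rw [← mul_assoc, ← pow_add, Nat.add_sub_cancel' h, pow_add]
    ring
  rw [this, Nat.mul_div_cancel_left _ (pow_pos hp c)]

/-- Lemma 2.5:  Let `p` be a prime and `m₁, …, m_{n-1}` positive integers with
`p ∤ m₁m₂⋯m_{n-1}`.  Fix `1 ≤ r ≤ n-1` and `K₀, …, K_r ∈ ℤ_{≥0}` with
`K₀ ≥ K₁ + ⋯ + K_r`.  Then
`A(p^{K₀},1,…,1) · A(p^{K₁}m₁, p^{K₂}m₂, …, p^{K_r}m_r, m_{r+1}, …, m_{n-1})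
= Σ_{k₁=0}^{K₁} ⋯ Σ_{k_r=0}^{K_r} A(p^L m₁, p^{K₂+k₁-k₂}m₂, …,
p^{K_r+k_{r-1}-k_r}m_r, p^{k_r}m_{r+1}, m_{r+2}, …, m_{n-1})`,
where `L = K₀ + K₁ - 2k₁ - k₂ - ⋯ - k_r`. -/
theorem statement5 (n : ℕ) (hn : 2 ≤ n) (A : (Fin (n - 1) → ℕ) → ℂ)
    (hA1 : A (fun _ => 1) = 1) (hA : HeckeRel n A)
    (p : ℕ) (hp : p.Prime)
    (m : Fin (n - 1) → ℕ) (hm : ∀ i, 0 < m i) (hpm : ¬ p ∣ ∏ i, m i)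
    (r : ℕ) (hr : 1 ≤ r) (hrn : r ≤ n - 1)
    (K : ℕ → ℕ) (hK : ∑ i ∈ Finset.Icc 1 r, K i ≤ K 0) :
    A (E n (p ^ K 0)) * A (fun i => pcoef n r p K i * m i) =
      ∑ k ∈ Fintype.piFinset (fun t : Fin r => Finset.range (K (t.val + 1) + 1)),
        A (fun i => tup n r p hr K k i * m i) := by
  have hp0 : 0 < p := hp.pos
  have hpm' : ∀ i, ¬ p ∣ m i := fun i h =>
    hpm (h.trans (Finset.dvd_prod_of_mem m (Finset.mem_univ i)))
  have hsum : ∀ k ∈ Fintype.piFinset (fun t : Fin r => Finset.range (K (t.val + 1) + 1)),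
      ∑ j, k j ≤ K 0 := by
    intro k hk
    rw [Fintype.mem_piFinset] at hk
    refine le_trans ?_ hK
    have h2 : ∑ i ∈ Finset.Icc 1 r, K i = ∑ j : Fin r, K (j.val + 1) := by
      rw [Fin.sum_univ_eq_sum_range (fun j => K (j + 1)), Finset.range_eq_Ico,
        Finset.sum_Ico_add' K 0 r 1]
      rfl
    rw [h2]
    apply Finset.sum_le_sum
    intro j _
    have := hk j
    rw [Finset.mem_range] at this
    omega
  have hpc : ∀ i, pcoef n r p K i = p ^ (if i.val < r then K (i.val + 1) else 0) := by
    intro i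
    unfold pcoef
    split_ifs <;> simp
  rw [hA (p ^ K 0) (pow_pos hp0 _) (fun i => pcoef n r p K i * m i)
    (fun i => by rw [hpc]; exact Nat.mul_pos (pow_pos hp0 _) (hm i))]
  symm
  refine Finset.sum_bij (fun k _ => fun i : Fin (n - 1) => p ^ kext r k i.val) ?_ ?_ ?_ ?_
  · intro k hk
    rw [Finset.mem_filter, Fintype.mem_piFinset, kext_prod _ _ _ hrn]
    refine ⟨fun i => ?_, pow_dvd_pow p (hsum k hk)⟩
    rw [Nat.mem_divisors, hpc]
    refine ⟨Dvd.dvd.mul_right (pow_dvd_pow p ?_) _,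
      (Nat.mul_pos (pow_pos hp0 _) (hm i)).ne'⟩
    rw [Fintype.mem_piFinset] at hk
    split_ifs with h
    · rw [kext_lt _ _ _ h]
      have := hk ⟨i.val, h⟩
      rw [Finset.mem_range] at this
      simp only at this
      omega
    · rw [kext_ge _ _ _ h]
  · intro k _ k' _ h
    funext t
    have := congrFun h ⟨t.val, by have := t.isLt; omega⟩
    have h3 := Nat.pow_right_injective hp.two_le this
    simpa [kext] using h3
  · intro c hc
    rw [Finset.mem_filter, Fintype.mem_piFinset] at hc
    obtain ⟨hc1, hc2⟩ := hc
    have hex : ∀ i : Fin (n - 1), ∃ e, e ≤ (if i.val < r then K (i.val + 1) else 0) ∧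
        c i = p ^ e := by
      intro i
      have hd : c i ∣ p ^ K 0 := (Finset.dvd_prod_of_mem c (Finset.mem_univ i)).trans hc2
      obtain ⟨e, _, he⟩ := (Nat.dvd_prime_pow hp).1 hd
      have h1 := Nat.dvd_of_mem_divisors (hc1 i)
      rw [hpc, he] at h1
      have hcop : Nat.Coprime (p ^ e) (m i) :=
        Nat.Coprime.pow_left _ ((Nat.Prime.coprime_iff_not_dvd hp).2 (hpm' i))
      have h2 := hcop.dvd_of_dvd_mul_right h1
      exact ⟨e, (Nat.pow_dvd_pow_iff_le_right hp.one_lt).1 h2, he⟩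
    choose e he1 he2 using hex
    refine ⟨fun t => e ⟨t.val, by have := t.isLt; omega⟩, ?_, ?_⟩
    · rw [Fintype.mem_piFinset]
      intro t
      have := he1 ⟨t.val, by have := t.isLt; omega⟩
      simp only [t.isLt, if_true] at this
      rw [Finset.mem_range]
      omega
    · funext i
      rw [he2 i]
      congr 1
      by_cases h : i.val < r
      · rw [kext_lt _ _ _ h]
      · rw [kext_ge _ _ _ h]
        have := he1 i
        rw [if_neg h] at this
        omega
  · intro k hk
    have hs := hsum k hk
    rw [Fintype.mem_piFinset] at hk
    congr 1
    funext i
    rw [kext_prod _ _ _ hrn, hpc, Nat.pow_div hs hp0]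
    by_cases h0 : i.val = 0
    · have hk0 := hk ⟨0, hr⟩
      rw [Finset.mem_range] at hk0
      simp only [zero_add] at hk0
      have hir : i.val < r := by omega
      simp only [tup, h0, if_true, zero_add]
      rw [if_pos (by omega : 0 < r), kext_lt _ _ 0 hr, div_aux _ _ _ _ _ hp0 (by omega)]
      congr 2
      omega
    · simp only [tup, h0, if_false]
      by_cases h : i.val < r
      · have hki := hk ⟨i.val, h⟩
        rw [Finset.mem_range] at hki
        simp only at hki
        rw [dif_pos h, if_pos h, kext_lt _ _ _ h, kext_lt _ _ (i.val - 1) (by omega),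
          div_aux _ _ _ _ _ hp0 (by omega)]
      · rw [dif_neg h, if_neg h, kext_ge _ _ _ h, div_aux _ _ _ _ _ hp0 (by omega)]
        by_cases hir : i.val = r
        · rw [if_pos hir, kext_lt _ _ (i.val - 1) (by omega)]
          simp [hir]
        · rw [if_neg hir, kext_ge _ _ (i.val - 1) (by omega)]
          simp
end

section
/- Let p be a prime and let m_1, m_2, …, m_{n−1} be positive integers with p ∤ m_1 m_2 ⋯ m_{n−1}. Then for every integer 1 ≤ r ≤ n−1 and all K_1, …, K_r ∈ ℤ_{≥0}, A(p^{K_1} m_1, …, p^{K_r} m_r, m_{r+1}, …, m_{n−1}) = A(p^{K_1}, …, p^{K_r}, 1, …, 1) · A(m_1, …, m_{n−1}), where in the first factor on the right the entries p^{K_1},…,p^{K_r} occupy the first r coordinates. -/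
def shiftK (N : ℕ) (K : ℕ → ℕ) : ℕ → ℕ := fun j => if j < N then K (j + 1) else 0

theorem T_eq (N : ℕ) (L a : ℕ → ℕ) (k : ℕ) (ha : ∀ j, a j ≤ L j) (hN : L N = 0) :
    ∑ i ∈ Finset.range (N + 1), i * (L i + (if i = 0 then k else a (i - 1)) - a i)
      = ∑ i ∈ Finset.range N, (i * L i + a i) := by
  have aN : a N = 0 := by have := ha N; omega
  have h1 : ∑ i ∈ Finset.range (N + 1), i * (L i + (if i = 0 then k else a (i - 1)) - a i)
      + ∑ i ∈ Finset.range (N + 1), i * a i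
      = ∑ i ∈ Finset.range (N + 1), i * L i
        + ∑ i ∈ Finset.range (N + 1), i * (if i = 0 then k else a (i - 1)) := by
    rw [← Finset.sum_add_distrib, ← Finset.sum_add_distrib]
    refine Finset.sum_congr rfl fun i _ => ?_
    rw [← mul_add, ← mul_add]
    congr 1
    have := ha i
    omega
  have h2 : ∑ i ∈ Finset.range (N + 1), i * (if i = 0 then k else a (i - 1))
      = ∑ i ∈ Finset.range N, (i * a i + a i) := by
    rw [Finset.sum_range_succ']
    simp [add_mul]
  rw [h2] at h1
  rw [Finset.sum_range_succ (fun i => i * a i), Finset.sum_range_succ (fun i => i * L i),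
    hN, aN, Finset.sum_add_distrib] at h1
  rw [Finset.sum_add_distrib]
  omega

theorem T_shift (N : ℕ) (K : ℕ → ℕ) :
    ∑ i ∈ Finset.range (N + 1), i * K i
      = ∑ i ∈ Finset.range N, (i * shiftK N K i + shiftK N K i) := by
  rw [Finset.sum_range_succ']
  simp only [zero_mul, add_zero]
  refine Finset.sum_congr rfl fun i hi => ?_
  rw [Finset.mem_range] at hi
  simp [shiftK, hi, add_mul]

theorem key (N p : ℕ) (hp : p.Prime) (G : (Fin (N + 1) → ℕ) → ℂ) (α : ℕ → ℂ)
    (h1 : G (fun _ => 1) = 0)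
    (hG : ∀ k : ℕ, ∀ K : ℕ → ℕ, α k * G (fun i => p ^ K i.val) =
      ∑ c ∈ Finset.filter (fun c : Fin (N + 1) → ℕ => (∏ i, c i) ∣ p ^ k)
          (Fintype.piFinset fun i : Fin (N + 1) => (p ^ K i.val).divisors),
        G (fun i => p ^ K i.val *
            (if i.val = 0 then p ^ k / ∏ j, c j else c ⟨i.val - 1, by have := i.isLt; omega⟩)
            / c i)) :
    ∀ t : ℕ, ∀ K : ℕ → ℕ, ∑ i ∈ Finset.range (N + 1), i * K i = t →
      G (fun i => p ^ K i.val) = 0 := by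
  intro t
  induction t using Nat.strong_induction_on with
  | _ t ih =>
  intro K hK
  set L := shiftK N K with hL
  have hLN : L N = 0 := by simp [hL, shiftK]
  have hT := T_shift N K
  rw [← hL, hK] at hT
  have hL0 : G (fun i => p ^ L i.val) = 0 := by
    by_cases hz : ∀ i ∈ Finset.range N, L i = 0
    · have : (fun i : Fin (N + 1) => p ^ L i.val) = fun _ => 1 := by
        funext i
        have : L i.val = 0 := by
          rcases Nat.lt_or_ge i.val N with h | h
          · exact hz _ (Finset.mem_range.2 h)
          · simp [hL, shiftK, not_lt.2 h]
        simp [this]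
      rw [this, h1]
    · push Not at hz
      obtain ⟨i, hi, hi0⟩ := hz
      refine ih _ ?_ L rfl
      rw [hT, Finset.sum_range_succ, hLN, mul_zero, add_zero]
      refine Finset.sum_lt_sum (fun _ _ => by omega) ⟨i, hi, by omega⟩
  have hsum : ∑ j : Fin (N + 1), L j.val + K 0 = ∑ i ∈ Finset.range (N + 1), K i := by
    rw [Fin.sum_univ_eq_sum_range, Finset.sum_range_succ, hLN, Finset.sum_range_succ' K, add_zero]
    congr 1
    refine Finset.sum_congr rfl fun i hi => ?_
    rw [Finset.mem_range] at hi
    simp [hL, shiftK, hi]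
  set k := ∑ i ∈ Finset.range (N + 1), K i with hk
  have hH := hG k L
  rw [hL0, mul_zero] at hH
  have hprod : ∏ j : Fin (N + 1), p ^ L j.val = p ^ (∑ j : Fin (N + 1), L j.val) :=
    Finset.prod_pow_eq_pow_sum _ _ _
  rw [Finset.sum_eq_single (fun i : Fin (N + 1) => p ^ L i.val)] at hH
  · rw [hH]
    congr 1
    funext i
    rw [Nat.mul_div_cancel_left _ (pow_pos hp.pos _)]
    split_ifs with h
    · rw [hprod, Nat.pow_div (by omega) hp.pos, h]
      congr 1; omega
    · congr 1
      have := i.isLt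
      simp only [hL, shiftK]
      rw [if_pos (by omega)]
      congr 1; omega
  · intro c hc hne
    rw [Finset.mem_filter, Fintype.mem_piFinset] at hc
    obtain ⟨hc, hck⟩ := hc
    have : ∀ j : ℕ, ∃ a, a ≤ L j ∧ ∀ h : j < N + 1, c ⟨j, h⟩ = p ^ a := by
      intro j
      by_cases h : j < N + 1
      · obtain ⟨a, h1, h2⟩ := (Nat.dvd_prime_pow hp).1 (Nat.dvd_of_mem_divisors (hc ⟨j, h⟩))
        exact ⟨a, h1, fun _ => h2⟩
      · exact ⟨0, Nat.zero_le _, fun h' => absurd h' h⟩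
    choose a ha hca using this
    have hca' : c = fun i => p ^ a i.val := funext fun i => hca i.val i.isLt
    have hprod' : ∏ j : Fin (N + 1), c j = p ^ (∑ j : Fin (N + 1), a j.val) := by
      rw [hca']; exact Finset.prod_pow_eq_pow_sum _ _ _
    rw [hprod'] at hck ⊢
    have hle := (Nat.pow_dvd_pow_iff_le_right hp.one_lt).1 hck
    set s := ∑ j : Fin (N + 1), a j.val
    have hne' : ∃ i ∈ Finset.range N, a i < L i := by
      by_contra hcon
      push Not at hcon
      apply hne
      rw [hca']
      funext i
      congr 1
      have h1 := ha i.val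
      rcases Nat.lt_or_ge i.val N with h | h
      · exact le_antisymm h1 (hcon _ (Finset.mem_range.2 h))
      · have : i.val = N := by have := i.isLt; omega
        rw [this] at h1 ⊢
        omega
    have := ih _ ?_ (fun i => L i + (if i = 0 then k - s else a (i - 1)) - a i) rfl
    · rw [← this]
      congr 1
      funext i
      have e : (if i.val = 0 then p ^ k / p ^ s else c ⟨i.val - 1, by have := i.isLt; omega⟩)
          = p ^ (if i.val = 0 then k - s else a (i.val - 1)) := by
        split_ifs with h
        · rw [Nat.pow_div hle hp.pos]
        · exact hca _ _
      rw [e, hca i.val i.isLt, ← pow_add, Nat.pow_div (by have := ha i.val; omega) hp.pos]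
    · rw [T_eq N L a _ ha hLN, hT]
      obtain ⟨i, hi, hlt⟩ := hne'
      exact Finset.sum_lt_sum (fun i _ => by have := ha i; omega) ⟨i, hi, by omega⟩
  · intro h
    exfalso
    apply h
    rw [Finset.mem_filter, Fintype.mem_piFinset]
    refine ⟨fun i => Nat.mem_divisors_self _ (pow_pos hp.pos _).ne', ?_⟩
    rw [hprod]
    exact pow_dvd_pow _ (by omega)

/-- Statement (2.6):  Let `p` be a prime and `m₁, …, m_{n-1}` positive integers
with `p ∤ m₁m₂⋯m_{n-1}`.  Then for every `1 ≤ r ≤ n-1` and all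
`K₁, …, K_r ∈ ℤ_{≥0}`,
`A(p^{K₁}m₁, …, p^{K_r}m_r, m_{r+1}, …, m_{n-1})
  = A(p^{K₁}, …, p^{K_r}, 1, …, 1) · A(m₁, …, m_{n-1})`. -/
theorem statement7 (n : ℕ) (hn : 2 ≤ n) (A : (Fin (n - 1) → ℕ) → ℂ)
    (hA1 : A (fun _ => 1) = 1) (hA : HeckeRel n A)
    (p : ℕ) (hp : p.Prime)
    (m : Fin (n - 1) → ℕ) (hm : ∀ i, 0 < m i) (hpm : ¬ p ∣ ∏ i, m i)
    (r : ℕ) (hr : 1 ≤ r) (hrn : r ≤ n - 1) (K : ℕ → ℕ) :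
    A (fun i => pcoef n r p K i * m i) = A (pcoef n r p K) * A m := by
  obtain ⟨N, rfl⟩ : ∃ N, n = N + 2 := ⟨n - 2, by omega⟩
  have hcop : ∀ i, Nat.Coprime p (m i) := fun i =>
    (Nat.Prime.coprime_iff_not_dvd hp).2 fun h =>
      hpm (h.trans (Finset.dvd_prod_of_mem _ (Finset.mem_univ i)))
  have := key N p hp (fun P => A (fun i => P i * m i) - A P * A m)
    (fun k => A (E (N + 2) (p ^ k))) (by
      have h1 : A (fun i => 1 * m i) = A m := by simp only [one_mul]
      show A (fun i => 1 * m i) - A (fun _ => 1) * A m = 0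
      rw [h1, hA1, one_mul, sub_self]) (by
      intro k L
      have e1 := hA (p ^ k) (pow_pos hp.pos _) (fun i => p ^ L i.val * m i)
        (fun i => Nat.mul_pos (pow_pos hp.pos _) (hm i))
      have e2 := hA (p ^ k) (pow_pos hp.pos _) (fun i => p ^ L i.val)
        (fun i => pow_pos hp.pos _)
      rw [mul_sub, ← mul_assoc, e1]
      refine (congrArg (fun z => _ - z * A m) e2).trans ?_
      rw [Finset.sum_sub_distrib, ← Finset.sum_mul]
      congr 1
      have hset : Finset.filter (fun c : Fin (N + 2 - 1) → ℕ => (∏ i, c i) ∣ p ^ k)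
          (Fintype.piFinset fun i => (p ^ L i.val * m i).divisors)
          = Finset.filter (fun c : Fin (N + 2 - 1) → ℕ => (∏ i, c i) ∣ p ^ k)
          (Fintype.piFinset fun i => (p ^ L i.val).divisors) := by
        ext c
        simp only [Finset.mem_filter, Fintype.mem_piFinset, Nat.mem_divisors]
        refine and_congr_left fun hc => forall_congr' fun i => ?_
        have hci : c i ∣ p ^ k := (Finset.dvd_prod_of_mem c (Finset.mem_univ i)).trans hc
        have hcc : Nat.Coprime (c i) (m i) :=
          Nat.Coprime.coprime_dvd_left hci ((hcop i).pow_left k)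
        have h1 : p ^ L i.val ≠ 0 := (pow_pos hp.pos _).ne'
        constructor
        · rintro ⟨h, -⟩
          exact ⟨hcc.dvd_of_dvd_mul_right h, h1⟩
        · rintro ⟨h, -⟩
          exact ⟨h.mul_right _, mul_ne_zero h1 (hm i).ne'⟩
      rw [hset]
      refine Finset.sum_congr rfl fun c hc => ?_
      congr 1
      funext i
      rw [Finset.mem_filter, Fintype.mem_piFinset] at hc
      have hd := Nat.dvd_of_mem_divisors (hc.1 i)
      rw [mul_right_comm, Nat.mul_div_right_comm (hd.mul_right _)]
      rfl)
    _ (fun i => if i < r then K (i + 1) else 0) rfl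
  have hP : pcoef (N + 2) r p K
      = fun i => p ^ ((fun i => if i < r then K (i + 1) else 0 : ℕ → ℕ) i.val) := by
    funext i
    simp only [pcoef]
    split_ifs <;> simp
  rw [hP]
  exact sub_eq_zero.1 this
end

section
/- Let p be a prime and let m_1, m_2, …, m_{n−1} be positive integers with p ∤ m_1 m_2 ⋯ m_{n−1}. Fix integers 1 ≤ r ≤ n−1 and K_0, K_1, …, K_r ∈ ℤ_{≥0} with K_0 ≥ K_1 + ⋯ + K_r and K_1 ≥ 1. Then A(p^{K_0},1,…,1)·A(p^{K_1}m_1, p^{K_2}m_2, …, p^{K_r}m_r, m_{r+1}, …, m_{n−1}) − A(p^{K_0+1},1,…,1)·A(p^{K_1−1}m_1, p^{K_2}m_2, …, p^{K_r}m_r, m_{r+1}, …, m_{n−1}) = Σ_{k_2=0}^{K_2} ⋯ Σ_{k_r=0}^{K_r} A(p^{K_0−K_1−k_2−⋯−k_r} m_1, p^{K_2+K_1−k_2} m_2, …, p^{K_r+k_{r−1}−k_r} m_r, p^{k_r} m_{r+1}, m_{r+2}, …, m_{n−1}). -/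
/-- The summand: exponents after the Hecke operator. -/
def hexp (n T : ℕ) (h0 : 0 < n - 1) (L k : Fin (n - 1) → ℕ) : Fin (n - 1) → ℕ :=
  fun i => if i.val = 0 then T - (k ⟨0, h0⟩ + ∑ j, k j)
    else L i + k ⟨i.val - 1, by have := i.isLt; omega⟩ - k i

lemma hecke_pp (n : ℕ) (h0 : 0 < n - 1) (A : (Fin (n - 1) → ℕ) → ℂ) (hA : HeckeRel n A)
    (p : ℕ) (hp : p.Prime)
    (m : Fin (n - 1) → ℕ) (hm : ∀ i, 0 < m i) (hpm : ¬ p ∣ ∏ i, m i)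
    (a : ℕ) (L : Fin (n - 1) → ℕ) (hL : ∑ i, L i ≤ a) :
    A (E n (p ^ a)) * A (fun i => p ^ L i * m i) =
      ∑ k ∈ Fintype.piFinset (fun i => Finset.range (L i + 1)),
        A (fun i => p ^ hexp n (a + L ⟨0, h0⟩) h0 L k i * m i) := by
  have hpi : ∀ i, ¬ p ∣ m i := fun i h => hpm (h.trans (Finset.dvd_prod_of_mem _ (Finset.mem_univ i)))
  rw [hA (p ^ a) (pow_pos hp.pos _) _ (fun i => Nat.mul_pos (pow_pos hp.pos _) (hm i))]
  symm
  refine Finset.sum_nbij (fun k i => p ^ k i) ?_ ?_ ?_ ?_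
  · intro k hk
    simp only [Fintype.mem_piFinset, Finset.mem_range] at hk
    simp only [Finset.mem_filter, Fintype.mem_piFinset, Nat.mem_divisors]
    refine ⟨fun i => ⟨Dvd.dvd.mul_right (pow_dvd_pow p (by have := hk i; omega)) _,
      (Nat.mul_pos (pow_pos hp.pos _) (hm i)).ne'⟩, ?_⟩
    rw [Finset.prod_pow_eq_pow_sum]
    apply pow_dvd_pow
    exact (Finset.sum_le_sum fun i _ => Nat.lt_succ_iff.mp (hk i)).trans hL
  · intro k _ k' _ h
    funext i
    exact Nat.pow_right_injective hp.two_le (congrFun h i)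
  · intro c hc
    simp only [Finset.coe_filter, Set.mem_setOf_eq, Fintype.mem_piFinset, Nat.mem_divisors] at hc
    have h1 : ∀ i, ∃ k, k ≤ a ∧ c i = p ^ k := fun i =>
      (Nat.dvd_prime_pow hp).1 ((Finset.dvd_prod_of_mem _ (Finset.mem_univ i)).trans hc.2)
    choose k hk hck using h1
    refine ⟨k, ?_, ?_⟩
    · simp only [Finset.mem_coe, Fintype.mem_piFinset, Finset.mem_range]
      intro i
      have h2 := (hc.1 i).1
      rw [hck i] at h2
      have h3 : Nat.Coprime (p ^ k i) (m i) :=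
        Nat.Coprime.pow_left _ ((Nat.Prime.coprime_iff_not_dvd hp).2 (hpi i))
      have h4 := h3.dvd_of_dvd_mul_right h2
      have := (Nat.pow_dvd_pow_iff_le_right hp.one_lt).1 h4
      omega
    · funext i
      exact (hck i).symm
  · intro k hk
    simp only [Fintype.mem_piFinset, Finset.mem_range] at hk
    have hs : ∑ j, k j ≤ a :=
      (Finset.sum_le_sum fun i _ => Nat.lt_succ_iff.mp (hk i)).trans hL
    congr 1
    funext i
    symm
    apply Nat.div_eq_of_eq_mul_left (pow_pos hp.pos _)
    have hki := hk i
    by_cases hi : i.val = 0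
    · have hi' : i = ⟨0, h0⟩ := Fin.ext hi
      simp only [hi, if_true, hexp]
      rw [Finset.prod_pow_eq_pow_sum, Nat.pow_div hs hp.pos]
      subst hi'
      have : a + L ⟨0, h0⟩ - (k ⟨0, h0⟩ + ∑ j, k j) + k ⟨0, h0⟩
        = L ⟨0, h0⟩ + (a - ∑ j, k j) := by omega
      rw [mul_right_comm, ← pow_add, mul_right_comm, ← pow_add, this]
    · simp only [hi, if_false, hexp]
      rw [mul_right_comm, ← pow_add, mul_right_comm, ← pow_add]
      congr 2
      omega

/-- Equation (2.8) ("NewIdentity2"):  Let `p` be a prime and `m₁, …, m_{n-1}` positive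
integers with `p ∤ m₁m₂⋯m_{n-1}`.  Fix `1 ≤ r ≤ n-1` and `K₀, …, K_r ∈ ℤ_{≥0}` with
`K₀ ≥ K₁ + ⋯ + K_r` and `K₁ ≥ 1`.  Then
`A(p^{K₀},1,…,1)·A(p^{K₁}m₁, …, p^{K_r}m_r, m_{r+1}, …, m_{n-1})
 - A(p^{K₀+1},1,…,1)·A(p^{K₁-1}m₁, …, p^{K_r}m_r, m_{r+1}, …, m_{n-1})
= Σ_{k₂=0}^{K₂} ⋯ Σ_{k_r=0}^{K_r} A(p^{K₀-K₁-k₂-⋯-k_r}m₁, p^{K₂+K₁-k₂}m₂, …,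
p^{K_r+k_{r-1}-k_r}m_r, p^{k_r}m_{r+1}, m_{r+2}, …, m_{n-1})`.
(The summand here is `tup` evaluated at `k₁ = K₁`, `k_t = κ_t` for `2 ≤ t ≤ r`,
multiplied coordinatewise by `m`, which agrees with the displayed tuple.) -/
theorem statement8 (n : ℕ) (hn : 2 ≤ n) (A : (Fin (n - 1) → ℕ) → ℂ)
    (hA1 : A (fun _ => 1) = 1) (hA : HeckeRel n A)
    (p : ℕ) (hp : p.Prime)
    (m : Fin (n - 1) → ℕ) (hm : ∀ i, 0 < m i) (hpm : ¬ p ∣ ∏ i, m i)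
    (r : ℕ) (hr : 1 ≤ r) (hrn : r ≤ n - 1)
    (K : ℕ → ℕ) (hK : ∑ i ∈ Finset.Icc 1 r, K i ≤ K 0) (hK1 : 1 ≤ K 1) :
    A (E n (p ^ K 0)) * A (fun i => pcoef n r p K i * m i)
      - A (E n (p ^ (K 0 + 1))) *
          A (fun i => pcoef n r p (Function.update K 1 (K 1 - 1)) i * m i) =
      ∑ κ ∈ Fintype.piFinset (fun t : Fin (r - 1) => Finset.range (K (t.val + 2) + 1)),
        A (fun i =>
          tup n r p hr K
            (fun t => if ht : t.val = 0 then K 1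
              else κ ⟨t.val - 1, by have := t.isLt; omega⟩) i * m i) := by
  have h0 : 0 < n - 1 := by omega
  set L : Fin (n - 1) → ℕ := fun i => if i.val < r then K (i.val + 1) else 0 with hLdef
  set L' : Fin (n - 1) → ℕ := Function.update L ⟨0, h0⟩ (K 1 - 1) with hL'def
  have hL0 : L ⟨0, h0⟩ = K 1 := by
    simp only [hLdef]; rw [if_pos (by omega)]
  have hL'0 : L' ⟨0, h0⟩ = K 1 - 1 := by simp [hL'def]
  have hL'i : ∀ i : Fin (n - 1), i.val ≠ 0 → L' i = L i := by
    intro i hi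
    rw [hL'def, Function.update_of_ne]
    intro h
    exact hi (by rw [h])
  have hL'le : ∀ i, L' i ≤ L i := by
    intro i
    by_cases hi : i.val = 0
    · have : i = ⟨0, h0⟩ := Fin.ext hi
      rw [this, hL'0, hL0]; omega
    · rw [hL'i i hi]
  have hsum : ∑ i, L i ≤ K 0 := by
    refine le_trans (le_of_eq ?_) hK
    simp only [hLdef]
    rw [Fin.sum_univ_eq_sum_range (fun i => if i < r then K (i + 1) else 0) (n - 1),
      ← Finset.sum_filter]
    have : Finset.filter (fun i => i < r) (Finset.range (n - 1)) = Finset.range r := by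
      ext x; simp only [Finset.mem_filter, Finset.mem_range]; omega
    rw [this, Finset.range_eq_Ico, Finset.sum_Ico_add' K 0 r 1]
    rfl
  have hsum' : ∑ i, L' i ≤ K 0 + 1 :=
    (Finset.sum_le_sum fun i _ => hL'le i).trans (hsum.trans (Nat.le_succ _))
  have e1 : (fun i => pcoef n r p K i * m i) = fun i => p ^ L i * m i := by
    funext i
    simp only [pcoef, hLdef]
    split_ifs <;> simp
  have e2 : (fun i => pcoef n r p (Function.update K 1 (K 1 - 1)) i * m i)
      = fun i => p ^ L' i * m i := by
    funext i
    congr 1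
    by_cases hi : i.val = 0
    · have : i = ⟨0, h0⟩ := Fin.ext hi
      rw [this, hL'0]
      simp only [pcoef]
      rw [if_pos (by omega)]
      simp
    · rw [hL'i i hi]
      simp only [pcoef, hLdef]
      split_ifs
      · rw [Function.update_of_ne (by omega)]
      · simp
  rw [e1, e2, hecke_pp n h0 A hA p hp m hm hpm _ L hsum,
    hecke_pp n h0 A hA p hp m hm hpm _ L' hsum']
  have hT : K 0 + 1 + L' ⟨0, h0⟩ = K 0 + L ⟨0, h0⟩ := by rw [hL'0, hL0]; omega
  have e3 : ∀ k, hexp n (K 0 + 1 + L' ⟨0, h0⟩) h0 L' k = hexp n (K 0 + L ⟨0, h0⟩) h0 L k := by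
    intro k
    funext i
    simp only [hexp, hT]
    split_ifs with hi
    · rfl
    · rw [hL'i i hi]
  simp only [e3]
  have e4 : Fintype.piFinset (fun i => Finset.range (L' i + 1)) =
      (Fintype.piFinset (fun i => Finset.range (L i + 1))).filter
        (fun k => ¬ k ⟨0, h0⟩ = K 1) := by
    ext k
    simp only [Fintype.mem_piFinset, Finset.mem_range, Finset.mem_filter]
    constructor
    · intro h
      refine ⟨fun i => lt_of_lt_of_le (h i) (Nat.succ_le_succ (hL'le i)), ?_⟩
      have := h ⟨0, h0⟩
      omega
    · rintro ⟨h, h'⟩ i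
      by_cases hi : i.val = 0
      · have h3 : i = ⟨0, h0⟩ := Fin.ext hi
        have := h ⟨0, h0⟩
        rw [h3, hL'0]
        omega
      · rw [hL'i i hi]; exact h i
  rw [e4, ← Finset.sum_filter_add_sum_filter_not (Fintype.piFinset (fun i => Finset.range (L i + 1)))
    (fun k => k ⟨0, h0⟩ = K 1), add_sub_cancel_right]
  refine Finset.sum_nbij'
    (fun k t => k ⟨t.val + 1, by have := t.isLt; omega⟩)
    (fun κ i => if hi : i.val = 0 then K 1 else if h : i.val < r then κ ⟨i.val - 1, by omega⟩ else 0)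
    ?_ ?_ ?_ ?_ ?_
  · intro k hk
    simp only [Fintype.mem_piFinset, Finset.mem_range, Finset.mem_filter] at hk ⊢
    intro t
    have h := hk.1 ⟨t.val + 1, by have := t.isLt; omega⟩
    simp only [hLdef] at h
    rw [if_pos (by have := t.isLt; omega)] at h
    exact h
  · intro κ hκ
    simp only [Fintype.mem_piFinset, Finset.mem_range, Finset.mem_filter] at hκ ⊢
    refine ⟨fun i => ?_, by simp⟩
    by_cases hi : i.val = 0
    · have h3 : i = ⟨0, h0⟩ := Fin.ext hi
      rw [dif_pos hi, h3, hL0]; omega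
    · rw [dif_neg hi]
      split_ifs with h
      · have h5 := hκ ⟨i.val - 1, by omega⟩
        simp only [hLdef]
        rw [if_pos h]
        have h6 : i.val - 1 + 2 = i.val + 1 := by omega
        simp only [h6] at h5
        exact h5
      · omega
  · intro k hk
    simp only [Fintype.mem_piFinset, Finset.mem_range, Finset.mem_filter] at hk
    funext i
    by_cases hi : i.val = 0
    · have h3 : i = ⟨0, h0⟩ := Fin.ext hi
      simp only [hi, dif_pos]
      rw [h3, hk.2]
    · simp only [hi, dif_neg, not_false_eq_true]
      split_ifs with h
      · congr 1
        apply Fin.ext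
        simp only
        omega
      · have h5 := hk.1 i
        simp only [hLdef] at h5
        rw [if_neg h] at h5
        omega
  · intro κ hκ
    funext t
    have := t.isLt
    simp only [Nat.add_eq_zero_iff, one_ne_zero, and_false, dif_neg, not_false_eq_true]
    rw [dif_pos (by omega)]
    rfl
  · intro k hk
    simp only [Fintype.mem_piFinset, Finset.mem_range, Finset.mem_filter] at hk
    obtain ⟨hk, hk0⟩ := hk
    have hz : ∀ i : Fin (n - 1), r ≤ i.val → k i = 0 := by
      intro i hi
      have h5 := hk i
      simp only [hLdef] at h5
      rw [if_neg (by omega)] at h5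
      omega
    have hkt : (fun t : Fin r => if ht : t.val = 0 then K 1
        else k ⟨t.val - 1 + 1, by have := t.isLt; omega⟩)
        = fun t : Fin r => k ⟨t.val, by have := t.isLt; omega⟩ := by
      funext t
      split_ifs with ht
      · rw [← hk0]; congr 1; exact Fin.ext ht.symm
      · congr 1; apply Fin.ext; simp only; omega
    have hks : ∑ j : Fin r, k ⟨j.val, by have := j.isLt; omega⟩ = ∑ j, k j := by
      have h7 := Fin.sum_univ_eq_sum_range (fun i => if h : i < n - 1 then k ⟨i, h⟩ else 0) (n - 1)
      have h8 := Fin.sum_univ_eq_sum_range (fun i => if h : i < n - 1 then k ⟨i, h⟩ else 0) r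
      have h9 : ∑ j, k j = ∑ i : Fin (n - 1), (fun i => if h : i < n - 1 then k ⟨i, h⟩ else 0) i.val :=
        Finset.sum_congr rfl (fun i _ => by simp)
      have h10 : ∑ j : Fin r, k ⟨j.val, by have := j.isLt; omega⟩
          = ∑ i : Fin r, (fun i => if h : i < n - 1 then k ⟨i, h⟩ else 0) i.val :=
        Finset.sum_congr rfl (fun i _ => by
          have := i.isLt
          simp only
          rw [dif_pos (by omega)])
      rw [h9, h10, h7, h8]
      apply Finset.sum_subset
      · intro x hx; simp only [Finset.mem_range] at hx ⊢; omega
      · intro x hx hx'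
        simp only [Finset.mem_range] at hx hx'
        rw [dif_pos hx]
        exact hz _ (by simpa using hx')
    congr 1
    funext i
    congr 1
    rw [hkt]
    simp only [tup, hexp]
    rw [hks, hL0]
    by_cases hi : i.val = 0
    · simp only [hi, if_true]
    · simp only [hi, if_false]
      by_cases h : i.val < r
      · rw [dif_pos h]
        simp only [hLdef, if_pos h]
      · rw [dif_neg h, hz i (by omega)]
        simp only [hLdef, if_neg h]
        split_ifs with h'
        · congr 1
          simp only [h', zero_add, Nat.sub_zero]
        · rw [hz _ (by simp only; omega)]
          simp
end

section
/- (Multiplicativity of Fourier Coefficients.) Let m_1, …, m_{n−1} and m_1', …, m_{n−1}' be positive integers such that gcd(∏_{i=1}^{n−1} m_i, ∏_{i=1}^{n−1} m_i') = 1. Then A(m_1 m_1', m_2 m_2', …, m_{n−1} m_{n−1}') = A(m_1, m_2, …, m_{n−1}) · A(m_1', m_2', …, m_{n−1}'). -/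
/-- index set of the Hecke sum -/
def HS (n m : ℕ) (N : Fin (n - 1) → ℕ) : Finset (Fin (n - 1) → ℕ) :=
  Finset.filter (fun c : Fin (n - 1) → ℕ => (∏ i, c i) ∣ m)
          (Fintype.piFinset fun i => (N i).divisors)

/-- shifted tuple -/
def HT (n m : ℕ) (N c : Fin (n - 1) → ℕ) : Fin (n - 1) → ℕ := fun i => N i *
            (if i.val = 0 then m / ∏ j, c j else c ⟨i.val - 1, by have := i.isLt; omega⟩)
            / c i

theorem mem_HS {n m : ℕ} {N c : Fin (n - 1) → ℕ} (hN : ∀ i, 0 < N i) :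
    c ∈ HS n m N ↔ (∀ i, c i ∣ N i) ∧ (∏ i, c i) ∣ m := by
  simp only [HS, Finset.mem_filter, Fintype.mem_piFinset, Nat.mem_divisors]
  constructor
  · rintro ⟨h, h'⟩; exact ⟨fun i => (h i).1, h'⟩
  · rintro ⟨h, h'⟩; exact ⟨fun i => ⟨h i, (hN i).ne'⟩, h'⟩

theorem HT_pos {n m : ℕ} (hm : 0 < m) {N c : Fin (n - 1) → ℕ} (hN : ∀ i, 0 < N i)
    (hc : ∀ i, c i ∣ N i) (hp : (∏ i, c i) ∣ m) (i) : 0 < HT n m N c i := by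
  have hcp : ∀ i, 0 < c i := fun i => Nat.pos_of_dvd_of_pos (hc i) (hN i)
  unfold HT
  apply Nat.div_pos _ (hcp i)
  refine (Nat.le_of_dvd (hN i) (hc i)).trans (Nat.le_mul_of_pos_right _ ?_)
  split_ifs
  · exact Nat.div_pos (Nat.le_of_dvd hm hp) (Finset.prod_pos fun i _ => hcp i)
  · exact hcp _

theorem HT_dvd {n m : ℕ} {N c : Fin (n - 1) → ℕ}
    (hc : ∀ i, c i ∣ N i) (hp : (∏ i, c i) ∣ m) (i) : HT n m N c i ∣ N i * m := by
  unfold HT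
  refine (Nat.div_dvd_of_dvd (Dvd.dvd.mul_right (hc i) _)).trans (mul_dvd_mul_left _ ?_)
  split_ifs
  · exact Nat.div_dvd_of_dvd hp
  · exact (Finset.dvd_prod_of_mem c (Finset.mem_univ _)).trans hp

theorem key_s9 {n : ℕ} (A : (Fin (n - 1) → ℕ) → ℂ) (hA : HeckeRel n A)
    (M' : Fin (n - 1) → ℕ) (hM' : ∀ i, 0 < M' i) (m : ℕ) (hm : 0 < m)
    (N : Fin (n - 1) → ℕ) (hN : ∀ i, 0 < N i) (hco : ∀ j, Nat.Coprime m (M' j))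
    (hG : A (fun i => N i * M' i) = A N * A M') (c0) (hc0 : c0 ∈ HS n m N)
    (hoth : ∀ c ∈ HS n m N, c ≠ c0 →
      A (fun i => HT n m N c i * M' i) = A (HT n m N c) * A M') :
    A (fun i => HT n m N c0 i * M' i) = A (HT n m N c0) * A M' := by
  have h1 : A (E n m) * A N = ∑ c ∈ HS n m N, A (HT n m N c) := hA m hm N hN
  have hNM : ∀ i, 0 < N i * M' i := fun i => Nat.mul_pos (hN i) (hM' i)
  have h2 : A (E n m) * A (fun i => N i * M' i) = ∑ c ∈ HS n m (fun i => N i * M' i),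
      A (HT n m (fun i => N i * M' i) c) := hA m hm _ hNM
  have hS : HS n m (fun i => N i * M' i) = HS n m N := by
    ext c
    rw [mem_HS hNM, mem_HS hN]
    refine and_congr_left fun hp => forall_congr' fun i => ?_
    have : c i ∣ m := (Finset.dvd_prod_of_mem c (Finset.mem_univ _)).trans hp
    exact ⟨fun h => (Nat.Coprime.coprime_dvd_left this (hco i)).dvd_of_dvd_mul_right h,
      fun h => h.mul_right _⟩
  have h3 : ∑ c ∈ HS n m N, A (fun i => HT n m N c i * M' i)
      = ∑ c ∈ HS n m N, A (HT n m N c) * A M' := by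
    rw [← Finset.sum_mul, ← h1, mul_assoc, ← hG, h2, hS]
    refine Finset.sum_congr rfl fun c hc => ?_
    congr 1
    funext i
    have := ((mem_HS hN).1 hc).1 i
    simp only [HT]
    rw [mul_right_comm, Nat.div_mul_right_comm (this.mul_right _)]
  rw [← Finset.add_sum_erase _ _ hc0, ← Finset.add_sum_erase _ _ hc0] at h3
  rw [Finset.sum_congr rfl (fun c hc => hoth c (Finset.mem_of_mem_erase hc)
    (Finset.ne_of_mem_erase hc))] at h3
  exact add_right_cancel h3

theorem main_ind_s9 {n : ℕ} (A : (Fin (n - 1) → ℕ) → ℂ) (hA1 : A (fun _ => 1) = 1)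
    (hA : HeckeRel n A)
    (M' : Fin (n - 1) → ℕ) (hM' : ∀ i, 0 < M' i) (r : ℕ) :
    ∀ M : Fin (n - 1) → ℕ, (∀ i, 0 < M i) → (∀ i j, Nat.Coprime (M i) (M' j)) →
      (∀ i, r ≤ i.val → M i = 1) → A (fun i => M i * M' i) = A M * A M' := by
  induction r with
  | zero =>
    intro M _ _ h
    have : M = fun _ => 1 := funext fun i => h i (Nat.zero_le _)
    subst this
    simp [hA1]
  | succ r ih =>
    by_cases hr : r < n - 1
    swap
    · intro M h1 h2 _
      exact ih M h1 h2 fun i hi => by have := i.isLt; omega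
    suffices H : ∀ k, ∀ M : Fin (n - 1) → ℕ, M ⟨r, hr⟩ = k → (∀ i, 0 < M i) →
        (∀ i j, Nat.Coprime (M i) (M' j)) →
        (∀ i, r + 1 ≤ i.val → M i = 1) → A (fun i => M i * M' i) = A M * A M' from
      fun M => H _ M rfl
    intro k
    induction k using Nat.strong_induction_on with
    | _ k ihk =>
    intro M hk hM hco hrow
    have hkpos : 0 < k := hk ▸ hM _
    have hkco : ∀ j, Nat.Coprime k (M' j) := fun j => hk ▸ hco _ j
    let N : Fin (n - 1) → ℕ := fun i => if i.val = r then 1 else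
      if i.val + 1 = r then M i * k else M i
    let c0 : Fin (n - 1) → ℕ := fun i => if i.val + 1 = r then k else 1
    have hN : ∀ i, 0 < N i := by
      intro i; simp only [N]; split_ifs
      · exact one_pos
      · exact Nat.mul_pos (hM i) hkpos
      · exact hM i
    have hNco : ∀ i j, Nat.Coprime (N i) (M' j) := by
      intro i j; simp only [N]; split_ifs
      · exact Nat.coprime_one_left _
      · exact Nat.Coprime.mul_left (hco i j) (hkco j)
      · exact hco i j
    have hNrow : ∀ i, r ≤ i.val → N i = 1 := by
      intro i hi; simp only [N]; split_ifs
      · rfl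
      · omega
      · exact hrow i (by omega)
    have hG := ih N hN hNco hNrow
    have hprod : (∏ i, c0 i) = if r = 0 then 1 else k := by
      split_ifs with h0
      · exact Finset.prod_eq_one fun i _ => by simp [c0, h0]
      · rw [Finset.prod_eq_single (⟨r - 1, by omega⟩ : Fin (n - 1))]
        · simp only [c0]; rw [if_pos (by omega)]
        · intro b _ hb
          simp only [c0]; rw [if_neg]
          intro h; apply hb; ext; simp; omega
        · simp
    have hc0 : c0 ∈ HS n k N := by
      rw [mem_HS hN]
      constructor
      · intro i; simp only [c0, N]
        split_ifs
        · omega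
        · exact Dvd.intro_left _ rfl
        · simp
        · simp
      · rw [hprod]; split_ifs <;> simp
    have hT : HT n k N c0 = M := by
      funext i
      simp only [HT, hprod]
      by_cases hi0 : i.val = 0
      · by_cases h0 : r = 0
        · have : i = ⟨r, hr⟩ := by ext; simp; omega
          subst this
          simp [N, c0, h0, hk]
          simpa [h0] using hk.symm
        · simp only [hi0, if_true, h0, if_false, Nat.div_self hkpos, mul_one, N, c0]
          split_ifs
          all_goals first
            | omega
            | exact Nat.mul_div_cancel _ hkpos
            | exact Nat.div_one _
      · simp only [hi0, if_false, N, c0]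
        by_cases h1 : i.val = r
        · have : i = ⟨r, hr⟩ := by ext; simp; omega
          subst this
          have h2 : r - 1 + 1 = r := by simp at hi0; omega
          simp [h2, hk]
        · have h2 : i.val - 1 + 1 ≠ r := by omega
          simp only [h1, h2, if_false]
          split_ifs
          · simp [Nat.mul_div_cancel _ hkpos]
          · simp
    rw [← hT]
    refine key_s9 A hA M' hM' k hkpos N hN hkco hG c0 hc0 ?_
    intro c hc hne
    obtain ⟨hcN, hcp⟩ := (mem_HS hN).1 hc
    have hc1 : ∀ i, r ≤ i.val → c i = 1 := fun i hi =>
      Nat.dvd_one.1 (hNrow i hi ▸ hcN i)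
    have hpos := HT_pos hkpos hN hcN hcp
    have hTco : ∀ i j, Nat.Coprime (HT n k N c i) (M' j) := fun i j =>
      Nat.Coprime.coprime_dvd_left (HT_dvd hcN hcp i)
        (Nat.Coprime.mul_left (hNco i j) (hkco j))
    have hTrow : ∀ i, r + 1 ≤ i.val → HT n k N c i = 1 := by
      intro i hi
      simp only [HT]
      rw [hNrow i (by omega), hc1 i (by omega), if_neg (by omega), hc1 _ (by simp; omega)]
    refine ihk (HT n k N c ⟨r, hr⟩) ?_ _ rfl hpos hTco hTrow
    by_cases h0 : r = 0
    · exfalso; apply hne; funext i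
      rw [hc1 i (by omega)]; simp [c0, h0]
    · simp only [HT]
      rw [hNrow _ le_rfl, hc1 ⟨r, hr⟩ le_rfl, if_neg h0, one_mul, Nat.div_one]
      have hd : c ⟨r - 1, by omega⟩ ∣ k :=
        (Finset.dvd_prod_of_mem c (Finset.mem_univ _)).trans hcp
      refine lt_of_le_of_ne (Nat.le_of_dvd hkpos hd) fun heq => hne ?_
      funext i
      by_cases hi : i.val + 1 = r
      · have : i = ⟨r - 1, by omega⟩ := by ext; simp; omega
        simp only [c0, hi, if_true]
        rw [this, heq]
      · simp only [c0, hi, if_false]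
        rw [← Finset.mul_prod_erase _ _ (Finset.mem_univ (⟨r - 1, by omega⟩ : Fin (n - 1))),
          heq] at hcp
        have h1 := Nat.dvd_of_mul_dvd_mul_left hkpos (hcp.trans (by rw [mul_one]) : _ ∣ k * 1)
        refine Nat.dvd_one.1 ((Finset.dvd_prod_of_mem c ?_).trans h1)
        refine Finset.mem_erase.2 ⟨fun h => hi ?_, Finset.mem_univ _⟩
        rw [h]; simp; omega

/-- Theorem 2.4 (Multiplicativity of Fourier Coefficients):  Let `m₁, …, m_{n-1}`
and `m₁', …, m_{n-1}'` be positive integers with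
`gcd(∏ᵢ mᵢ, ∏ᵢ mᵢ') = 1`.  Then
`A(m₁m₁', m₂m₂', …, m_{n-1}m_{n-1}') = A(m₁, …, m_{n-1}) · A(m₁', …, m_{n-1}')`. -/
theorem statement9 (n : ℕ) (hn : 2 ≤ n) (A : (Fin (n - 1) → ℕ) → ℂ)
    (hA1 : A (fun _ => 1) = 1) (hA : HeckeRel n A)
    (m m' : Fin (n - 1) → ℕ) (hm : ∀ i, 0 < m i) (hm' : ∀ i, 0 < m' i)
    (hco : Nat.gcd (∏ i, m i) (∏ i, m' i) = 1) :
    A (fun i => m i * m' i) = A m * A m' := by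
  refine main_ind_s9 A hA1 hA m' hm' n m hm (fun i j => ?_) (fun i hi => by have := i.isLt; omega)
  exact Nat.Coprime.coprime_dvd_left (Finset.dvd_prod_of_mem m (Finset.mem_univ i))
    (Nat.Coprime.coprime_dvd_right (Finset.dvd_prod_of_mem m' (Finset.mem_univ j)) hco)
end

section
/- Let p be a prime and let 1 ≤ ℓ ≤ n−1. Let C_ℓ denote the set of compositions of ℓ, i.e., ordered tuples (i_1, i_2, …, i_r) of positive integers (r ≥ 1) with i_1 + i_2 + ⋯ + i_r = ℓ. Then A(1, …, 1, p, 1, …, 1), with p occurring in the ℓ-th coordinate, equals Σ_{(i_1,…,i_r) ∈ C_ℓ} ∏_{j=1}^{r} (−1)^{i_j+1} A(p^{i_j}, 1, …, 1). -/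
theorem comp_sum_rec (f : ℕ → ℂ) (m : ℕ) :
    ∑ c : Composition (m + 1), (c.blocks.map f).prod =
      ∑ i : Fin (m + 1), f (i.val + 1) * ∑ c : Composition (m - i.val), (c.blocks.map f).prod := by
  simp_rw [Finset.mul_sum]
  rw [Finset.sum_sigma']
  symm
  refine Finset.sum_bij (fun x _ => (⟨(x.1.val + 1) :: x.2.blocks, ?_, ?_⟩ : Composition (m + 1)))
    ?_ ?_ ?_ ?_
  · intro i hi
    rcases List.mem_cons.1 hi with h | h
    · omega
    · exact x.2.blocks_pos h
  · have := x.1.isLt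
    rw [List.sum_cons, x.2.blocks_sum]
    omega
  · intros; simp
  · rintro ⟨i, c⟩ _ ⟨j, d⟩ _ h
    have h2 := congrArg Composition.blocks h
    simp only [List.cons.injEq, add_left_inj] at h2
    obtain ⟨h3, h4⟩ := h2
    have h5 : i = j := Fin.ext h3
    subst h5
    have h6 : c = d := Composition.ext h4
    rw [h6]
  · rintro ⟨b, hb, hs⟩ _
    cases b with
    | nil => simp at hs
    | cons a t =>
      have ha : 0 < a := hb (by simp)
      rw [List.sum_cons] at hs
      refine ⟨⟨⟨a - 1, by omega⟩, ⟨t, fun h => hb (by simp [h]), ?_⟩⟩, Finset.mem_univ _, ?_⟩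
      · simp only; omega
      · apply Composition.ext
        simp only [List.cons.injEq, and_true]
        omega
  · intros; simp

/-- `p^k` in the first coordinate times `p` in the `l`-th. -/
def Bt (n p k l : ℕ) : Fin (n - 1) → ℕ :=
  fun i => (if i.val = 0 then p ^ k else 1) * (if i.val + 1 = l then p else 1)

theorem hecke_step (n : ℕ) (A : (Fin (n - 1) → ℕ) → ℂ) (hA : HeckeRel n A)
    (p : ℕ) (hp : p.Prime) (k l : ℕ) (hl : 1 ≤ l) (hln : l ≤ n - 1) :
    A (E n (p ^ (k + 1))) * A (Bt n p 0 l) = A (Bt n p (k + 1) l) + A (Bt n p k (l + 1)) := by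
  have hp0 := hp.pos
  have hp1 := hp.one_lt
  have hprod : (∏ i : Fin (n - 1), if i.val + 1 = l then p else 1) = p := by
    rw [Finset.prod_eq_single (⟨l - 1, by omega⟩ : Fin (n - 1))]
    · simp only; rw [if_pos (by omega)]
    · intro b _ hb
      rw [if_neg]
      intro h
      apply hb
      apply Fin.ext
      simp only; omega
    · simp
  rw [hA (p ^ (k + 1)) (by positivity) (Bt n p 0 l) (by
    intro i; unfold Bt; split_ifs <;> simp [hp0])]
  have hset : Finset.filter (fun c : Fin (n - 1) → ℕ => (∏ i, c i) ∣ p ^ (k + 1))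
      (Fintype.piFinset fun i => (Bt n p 0 l i).divisors) =
      {fun _ => 1, fun i => if i.val + 1 = l then p else 1} := by
    ext c
    simp only [Finset.mem_filter, Fintype.mem_piFinset, Finset.mem_insert, Finset.mem_singleton]
    constructor
    · rintro ⟨h, -⟩
      have h1 : ∀ i : Fin (n - 1), i.val + 1 ≠ l → c i = 1 := by
        intro i hi
        have := h i
        simpa [Bt, hi] using this
      have h2 := h ⟨l - 1, by omega⟩
      have hl' : l - 1 + 1 = l := by omega
      simp only [Bt, pow_zero, ite_self, hl', if_true, one_mul] at h2
      rcases (Nat.dvd_prime hp).1 (Nat.dvd_of_mem_divisors h2) with h3 | h3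
      · left
        funext i
        by_cases hi : i.val + 1 = l
        · have : i = ⟨l - 1, by omega⟩ := Fin.ext (by simp only; omega)
          rw [this, h3]
        · exact h1 i hi
      · right
        funext i
        by_cases hi : i.val + 1 = l
        · have : i = ⟨l - 1, by omega⟩ := Fin.ext (by simp only; omega)
          rw [if_pos hi, this, h3]
        · rw [if_neg hi]; exact h1 i hi
    · rintro (rfl | rfl)
      · refine ⟨fun i => ?_, by simp⟩
        simp only [Bt]
        split_ifs <;> simp [hp0.ne']
      · refine ⟨fun i => ?_, ?_⟩
        · simp only [Bt]
          split_ifs <;> simp [hp0.ne']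
        · rw [hprod]; exact dvd_pow_self p (by omega)
  rw [hset, Finset.sum_pair]
  · congr 1
    · congr 1
      funext i
      simp [Bt, mul_comm]
    · congr 1
      funext i
      rw [hprod]
      have hk : p ^ (k + 1) / p = p ^ k := by
        rw [pow_succ]; exact Nat.mul_div_cancel _ hp0
      rw [hk]
      simp only [Bt, pow_zero, ite_self, one_mul]
      by_cases hi : i.val = 0
      · have h2 : ¬ (i.val + 1 = l + 1) := by omega
        simp only [if_pos hi, if_neg h2, mul_one]
        split_ifs
        · exact Nat.mul_div_cancel_left _ hp0
        · simp
      · have e : i.val - 1 + 1 = i.val := by omega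
        simp only [if_neg hi, e, one_mul, add_left_inj]
        by_cases h3 : i.val + 1 = l
        · have h4 : ¬ (i.val = l) := by omega
          simp [h3, h4, hp0]
        · simp [h3]
  · intro h
    have := congrFun h ⟨l - 1, by omega⟩
    have hl' : l - 1 + 1 = l := by omega
    simp only [hl', if_true] at this
    omega

theorem main_aux (n : ℕ) (A : (Fin (n - 1) → ℕ) → ℂ)
    (hA : HeckeRel n A) (p : ℕ) (hp : p.Prime)
    (ℓ : ℕ) : ∀ j, j < ℓ → ℓ ≤ n - 1 →
    ∑ i ∈ Finset.range j, (-1 : ℂ) ^ (i + 1 + 1) * A (E n (p ^ (i + 1))) *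
      A (Bt n p 0 (ℓ - 1 - i)) = A (Bt n p 0 ℓ) - (-1) ^ j * A (Bt n p j (ℓ - j)) := by
  intro j
  induction j with
  | zero => intro _ _; simp
  | succ j ih =>
    intro h1 h2
    rw [Finset.sum_range_succ, ih (by omega) h2, mul_assoc,
      hecke_step n A hA p hp j (ℓ - 1 - j) (by omega) (by omega)]
    have e1 : ℓ - 1 - j + 1 = ℓ - j := by omega
    have e2 : ℓ - 1 - j = ℓ - (j + 1) := by omega
    rw [e1, e2]
    ring

/-- Proposition 3.1:  Let `p` be a prime and `1 ≤ ℓ ≤ n-1`.  Then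
`A(1, …, 1, p, 1, …, 1)` (with `p` in the `ℓ`-th coordinate) equals
`Σ_{(i₁,…,i_r) ∈ C_ℓ} ∏_{j=1}^{r} (-1)^{i_j+1} A(p^{i_j}, 1, …, 1)`,
where `C_ℓ` is the set of compositions of `ℓ`. -/
theorem statement11 (n : ℕ) (hn : 2 ≤ n) (A : (Fin (n - 1) → ℕ) → ℂ)
    (hA1 : A (fun _ => 1) = 1) (hA : HeckeRel n A)
    (p : ℕ) (hp : p.Prime)
    (ℓ : ℕ) (hℓ1 : 1 ≤ ℓ) (hℓn : ℓ ≤ n - 1) :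
    A (fun i => if i.val = ℓ - 1 then p else 1) =
      ∑ c : Composition ℓ,
        (c.blocks.map fun ij => (-1 : ℂ) ^ (ij + 1) * A (E n (p ^ ij))).prod := by
  have key : ∀ m, m ≤ n - 1 → A (Bt n p 0 m) = ∑ c : Composition m,
        (c.blocks.map fun ij => (-1 : ℂ) ^ (ij + 1) * A (E n (p ^ ij))).prod := by
    have hz : A (Bt n p 0 0) = 1 := by
      rw [← hA1]; congr 1; funext i; simp [Bt]
    intro m
    induction m using Nat.strong_induction_on with
    | _ m ih =>
      intro hm
      cases m with
      | zero =>
        rw [hz]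
        have : ∀ c : Composition 0, c.blocks = [] := fun c => by
          have h := c.blocks_sum
          rcases hb : c.blocks with _ | ⟨a, t⟩
          · rfl
          · have h3 : 0 < a := c.blocks_pos (by rw [hb]; simp)
            rw [hb, List.sum_cons] at h
            omega
        simp [this, composition_card]
      | succ m =>
        rw [comp_sum_rec (fun ij => (-1 : ℂ) ^ (ij + 1) * A (E n (p ^ ij))) m]
        have h1 := main_aux n A hA p hp (m + 1) m (by omega) hm
        have e : Bt n p m (m + 1 - m) = E n (p ^ (m + 1)) := by
          funext i
          simp only [Bt, E, Nat.add_sub_cancel_left]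
          by_cases hi : i.val = 0
          · simp [hi, pow_succ]
          · simp [hi]
        rw [e] at h1
        have h2 : ∑ i : Fin (m + 1), ((-1 : ℂ) ^ (i.val + 1 + 1) * A (E n (p ^ (i.val + 1)))) *
            A (Bt n p 0 (m + 1 - 1 - i.val)) = A (Bt n p 0 (m + 1)) := by
          rw [Fin.sum_univ_eq_sum_range (fun i => (-1 : ℂ) ^ (i + 1 + 1) *
            A (E n (p ^ (i + 1))) * A (Bt n p 0 (m + 1 - 1 - i))), Finset.sum_range_succ, h1]
          have e3 : m + 1 - 1 - m = 0 := by omega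
          rw [e3, hz]
          ring
        rw [← h2]
        refine Finset.sum_congr rfl fun i _ => ?_
        rw [ih (m + 1 - 1 - i.val) (by omega) (by omega)]
        rfl
  rw [← key ℓ hℓn]
  congr 1
  funext i
  have : (i.val = ℓ - 1) ↔ (i.val + 1 = ℓ) := by omega
  simp [Bt, this]
end

section
/- Let p be a prime, j ∈ ℤ_{≥1}, and 1 ≤ k ≤ n−1. Then A_{j,0}(p) · A_{0,k}(p) = A_{j,k}(p) + A_{j−1,k+1}(p). -/
/-- `Ajk n A p j k` is `A_{j,k}(p)`:  the result of multiplying the `k`-th coordinate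
of the argument of `A(p^j, 1, …, 1)` by `p`, where `k = 0` and `k = n` correspond to
no extra factor of `p` (so it equals `A(p^j,1,…,1)` if `k = 0` or `k = n`,
`A(p^{j+1},1,…,1)` if `k = 1`, and `A(p^j,1,…,1,p,1,…,1)` with `p` in the `k`-th
coordinate if `2 ≤ k ≤ n-1`). -/
noncomputable def Ajk (n : ℕ) (A : (Fin (n - 1) → ℕ) → ℂ) (p j k : ℕ) : ℂ :=
  if k = 0 ∨ k = n then A (E n (p ^ j))
  else if k = 1 then A (E n (p ^ (j + 1)))
  else A (fun i => if i.val = 0 then p ^ j else if i.val = k - 1 then p else 1)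

/-- Lemma 3.3:  Let `p` be a prime, `j ∈ ℤ_{≥1}`, and `1 ≤ k ≤ n-1`.  Then
`A_{j,0}(p) · A_{0,k}(p) = A_{j,k}(p) + A_{j-1,k+1}(p)`. -/
theorem statement12 (n : ℕ) (hn : 2 ≤ n) (A : (Fin (n - 1) → ℕ) → ℂ)
    (hA1 : A (fun _ => 1) = 1) (hA : HeckeRel n A)
    (p : ℕ) (hp : p.Prime)
    (j : ℕ) (hj : 1 ≤ j) (k : ℕ) (hk1 : 1 ≤ k) (hkn : k ≤ n - 1) :
    Ajk n A p j 0 * Ajk n A p 0 k = Ajk n A p j k + Ajk n A p (j - 1) (k + 1) := by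
  obtain ⟨j, rfl⟩ : ∃ j', j = j' + 1 := ⟨j - 1, by omega⟩
  obtain ⟨k, rfl⟩ : ∃ k', k = k' + 1 := ⟨k - 1, by omega⟩
  have hp0 := hp.pos
  have hp1 := hp.one_lt
  let M : Fin (n - 1) → ℕ := fun i => if i.val = k then p else 1
  let k0 : Fin (n - 1) := ⟨k, by omega⟩
  have hMk : ∀ i, M i = if i.val = k then p else 1 := fun i => rfl
  have hM : ∀ i, 0 < M i := by
    intro i; rw [hMk]; split_ifs <;> omega
  have hprod : ∏ i, M i = p := by
    rw [Finset.prod_eq_single k0]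
    · simp [hMk, k0]
    · intro b _ hb
      rw [hMk, if_neg]
      intro h; exact hb (Fin.ext h)
    · simp
  have hne : (fun _ => 1 : Fin (n - 1) → ℕ) ≠ M := by
    intro h
    have := congrFun h k0
    simp [hMk, k0] at this
    omega
  have hset : Finset.filter (fun c : Fin (n - 1) → ℕ => (∏ i, c i) ∣ p ^ (j + 1))
          (Fintype.piFinset fun i => (M i).divisors) = {(fun _ => 1), M} := by
    ext c
    simp only [Finset.mem_filter, Fintype.mem_piFinset, Nat.mem_divisors, Finset.mem_insert,
      Finset.mem_singleton]
    constructor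
    · rintro ⟨h, -⟩
      have h1 : ∀ i, i ≠ k0 → c i = 1 := by
        intro i hi
        have h2 := (h i).1
        rw [hMk, if_neg (fun e => hi (Fin.ext e))] at h2
        exact Nat.dvd_one.mp h2
      have h2 := (h k0).1
      rw [hMk, if_pos rfl] at h2
      rcases (Nat.dvd_prime hp).mp h2 with h3 | h3
      · left
        funext i
        by_cases hi : i = k0
        · rw [hi, h3]
        · exact h1 i hi
      · right
        funext i
        by_cases hi : i = k0
        · rw [hi, h3, hMk, if_pos rfl]
        · rw [h1 i hi, hMk, if_neg (fun e => hi (Fin.ext e))]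
    · rintro (rfl | rfl)
      · exact ⟨fun i => ⟨one_dvd _, (hM i).ne'⟩, by simp⟩
      · exact ⟨fun i => ⟨dvd_rfl, (hM i).ne'⟩, by rw [hprod]; exact dvd_pow_self p (by omega)⟩
  have key := hA (p ^ (j + 1)) (by positivity) M hM
  rw [hset, Finset.sum_pair hne, hprod] at key
  have e0 : Ajk n A p (j + 1) 0 = A (E n (p ^ (j + 1))) := by simp [Ajk]
  have e1 : Ajk n A p 0 (k + 1) = A M := by
    unfold Ajk
    rw [if_neg (by omega)]
    split_ifs with h
    · congr 1; funext i
      have : k = 0 := by omega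
      simp [E, hMk, this]
    · congr 1; funext i
      rw [hMk]
      split_ifs <;> first | rfl | omega | simp
  rw [e0, e1, key]
  congr 1
  · unfold Ajk
    rw [if_neg (by omega)]
    split_ifs with h
    · congr 1; funext i
      have : k = 0 := by omega
      simp only [E, hMk, this, Finset.prod_const_one, Nat.div_one]
      split_ifs <;> ring
    · congr 1; funext i
      simp only [hMk, Finset.prod_const_one, Nat.div_one]
      split_ifs <;> first | rfl | omega | simp
  · have hd : ∀ i x, M i * x / M i = x := fun i x => Nat.mul_div_cancel_left x (hM i)
    have hq : p ^ (j + 1) / p = p ^ j := by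
      rw [pow_succ]; exact Nat.mul_div_cancel _ hp0
    simp only [hd, hq]
    unfold Ajk
    by_cases h : k + 1 + 1 = n
    · rw [if_pos (Or.inr h)]
      congr 1; funext i
      have := i.isLt
      simp only [E, hMk]
      split_ifs <;> first | rfl | omega
    · rw [if_neg (by omega), if_neg (by omega)]
      congr 1; funext i
      simp only [hMk]
      split_ifs <;> first | rfl | omega
end

section
/- Let p be a prime and 2 ≤ ℓ ≤ n−1. Then A(1, …, 1, p, 1, …, 1), with p in the ℓ-th coordinate, equals Σ_{m=1}^{ℓ} (−1)^{m+1} A(p^m, 1, …, 1) · B_{ℓ−m}, where B_{ℓ−m} := A(1, …, 1, p, 1, …, 1) with p in the (ℓ−m)-th coordinate when 1 ≤ ℓ−m, and B_0 := 1 when m = ℓ. -/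
def FF (n : ℕ) (A : (Fin (n - 1) → ℕ) → ℂ) (p a j : ℕ) : ℂ :=
  A (fun i => (if i.val = 0 then p ^ a else 1) * (if i.val = j then p else 1))

theorem key_s13 (n : ℕ) (A : (Fin (n - 1) → ℕ) → ℂ) (hA : HeckeRel n A)
    (p : ℕ) (hp : p.Prime) (a j : ℕ) (hj : j + 1 < n - 1) :
    A (E n (p ^ (a + 1))) * A (fun i => if i.val = j then p else 1) =
      FF n A p (a + 1) j + FF n A p a (j + 1) := by
  have hp0 := hp.pos
  have hp1 := hp.one_lt
  rw [hA (p ^ (a + 1)) (pow_pos hp0 _) _ (by intro i; split_ifs <;> omega)]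
  have hprod : ∏ i : Fin (n - 1), (if i.val = j then p else 1) = p := by
    rw [Finset.prod_eq_single (⟨j, by omega⟩ : Fin (n - 1))]
    · simp
    · intro b _ hb
      rw [if_neg]
      intro h
      exact hb (Fin.ext h)
    · simp
  have hset : Finset.filter (fun c : Fin (n - 1) → ℕ => (∏ i, c i) ∣ p ^ (a + 1))
      (Fintype.piFinset fun i => (if i.val = j then p else 1 : ℕ).divisors) =
      {(fun _ => 1), (fun i => if i.val = j then p else 1)} := by
    ext c
    simp only [Finset.mem_filter, Fintype.mem_piFinset, Finset.mem_insert, Finset.mem_singleton]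
    constructor
    · rintro ⟨h, -⟩
      have hne : ∀ i : Fin (n - 1), i.val ≠ j → c i = 1 := by
        intro i hi
        have := h i
        rw [if_neg hi] at this
        simpa using this
      have hjj := h ⟨j, by omega⟩
      rw [if_pos rfl, Nat.mem_divisors, Nat.dvd_prime hp] at hjj
      rcases hjj.1 with h1 | h1
      · left
        funext i
        by_cases hi : i.val = j
        · rw [← h1]; congr 1; exact Fin.ext hi
        · exact hne i hi
      · right
        funext i
        by_cases hi : i.val = j
        · rw [if_pos hi, ← h1]; congr 1; exact Fin.ext hi
        · rw [if_neg hi]; exact hne i hi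
    · rintro (rfl | rfl)
      · refine ⟨fun i => ?_, by simp⟩
        rw [Nat.mem_divisors]
        refine ⟨one_dvd _, ?_⟩
        split_ifs <;> omega
      · refine ⟨fun i => ?_, ?_⟩
        · rw [Nat.mem_divisors]
          refine ⟨dvd_rfl, ?_⟩
          split_ifs <;> omega
        · rw [hprod]; exact dvd_pow_self p (by omega)
  rw [hset, Finset.sum_pair]
  · congr 1
    · unfold FF
      congr 1
      funext i
      simp [mul_comm]
    · unfold FF
      congr 1
      funext i
      rw [hprod]
      have hdiv : p ^ (a + 1) / p = p ^ a := by
        rw [pow_succ]; exact Nat.mul_div_cancel _ hp0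
      rw [hdiv]
      dsimp only
      have hpos : 0 < (if i.val = j then p else 1) := by split_ifs <;> omega
      rw [Nat.mul_div_cancel_left _ hpos]
      by_cases h0 : i.val = 0
      · rw [if_pos h0, if_pos h0, if_neg (by omega), mul_one]
      · rw [if_neg h0, if_neg h0, one_mul]
        by_cases h1 : i.val = j + 1
        · rw [if_pos h1, if_pos (by omega)]
        · rw [if_neg h1, if_neg (by omega)]
  · intro h
    have := congrFun h ⟨j, by omega⟩
    simp at this
    omega

/-- Lemma 3.4:  Let `p` be a prime and `2 ≤ ℓ ≤ n-1`.  Then `A(1,…,1,p,1,…,1)`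
(with `p` in the `ℓ`-th coordinate) equals
`Σ_{m=1}^{ℓ} (-1)^{m+1} A(p^m,1,…,1) · B_{ℓ-m}`, where `B_{ℓ-m}` denotes
`A(1,…,1,p,1,…,1)` with `p` in the `(ℓ-m)`-th coordinate when `ℓ-m ≥ 1`, and
`B_0 := 1` when `m = ℓ`. -/
theorem statement13 (n : ℕ) (hn : 2 ≤ n) (A : (Fin (n - 1) → ℕ) → ℂ)
    (hA1 : A (fun _ => 1) = 1) (hA : HeckeRel n A)
    (p : ℕ) (hp : p.Prime)
    (ℓ : ℕ) (hℓ2 : 2 ≤ ℓ) (hℓn : ℓ ≤ n - 1) :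
    A (fun i => if i.val = ℓ - 1 then p else 1) =
      ∑ m ∈ Finset.Icc 1 ℓ, (-1 : ℂ) ^ (m + 1) * A (E n (p ^ m)) *
        (if m = ℓ then 1 else A (fun i => if i.val = ℓ - m - 1 then p else 1)) := by
  have hpart : ∀ k, k + 1 ≤ ℓ → ∑ m ∈ Finset.Icc 1 k, (-1 : ℂ) ^ (m + 1) * A (E n (p ^ m)) *
        (if m = ℓ then 1 else A (fun i => if i.val = ℓ - m - 1 then p else 1)) =
      FF n A p 0 (ℓ - 1) + (-1) ^ (k + 1) * FF n A p k (ℓ - k - 1) := by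
    intro k
    induction k with
    | zero => intro _; simp
    | succ k ih =>
      intro hk
      rw [Finset.sum_Icc_succ_top (by omega), ih (by omega), if_neg (by omega), mul_assoc,
        key_s13 n A hA p hp k (ℓ - (k + 1) - 1) (by omega)]
      have : ℓ - (k + 1) - 1 + 1 = ℓ - k - 1 := by omega
      rw [this]
      ring
  obtain ⟨k, rfl⟩ : ∃ k, ℓ = k + 1 := ⟨ℓ - 1, by omega⟩
  rw [Finset.sum_Icc_succ_top (by omega), hpart k le_rfl, if_pos rfl]
  have h1 : FF n A p k (k + 1 - k - 1) = A (E n (p ^ (k + 1))) := by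
    unfold FF E
    congr 1
    funext i
    have : k + 1 - k - 1 = 0 := by omega
    rw [this]
    split_ifs
    · rw [pow_succ]
    · rfl
  have h2 : FF n A p 0 (k + 1 - 1) = A (fun i => if i.val = k + 1 - 1 then p else 1) := by
    unfold FF
    congr 1
    funext i
    simp
  rw [h1, h2]
  ring
end

section
/- Suppose n ≥ 3. Let p be a prime and j ∈ ℤ_{≥1}. Then A(1, p^j, 1, …, 1) = A(p^j, 1, …, 1)^2 − A(p^{j−1}, 1, …, 1) · A(p^{j+1}, 1, …, 1). -/
theorem prodE (n m : ℕ) (hn : 3 ≤ n) : ∏ i, E n m i = m := by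
  rw [Finset.prod_eq_single (⟨0, by omega⟩ : Fin (n - 1))]
  · simp [E]
  · intro b _ hb
    have : b.val ≠ 0 := fun h => hb (Fin.ext h)
    simp [E, this]
  · simp

theorem heckePow (n : ℕ) (hn : 3 ≤ n) (A : (Fin (n - 1) → ℕ) → ℂ) (hA : HeckeRel n A)
    (p : ℕ) (hp : p.Prime) (a b : ℕ) (hab : a ≤ b) :
    A (E n (p ^ a)) * A (E n (p ^ b)) = ∑ k ∈ Finset.range (a + 1),
      A (fun i => if i.val = 0 then p ^ (a + b - 2 * k) else if i.val = 1 then p ^ k else 1) := by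
  have hpos : ∀ k, 0 < p ^ k := fun k => pow_pos hp.pos k
  rw [hA (p ^ a) (hpos a) (E n (p ^ b)) (by
    intro i; unfold E; split_ifs
    · exact hpos b
    · exact one_pos)]
  have hset : Finset.filter (fun c : Fin (n - 1) → ℕ => (∏ i, c i) ∣ p ^ a)
      (Fintype.piFinset fun i => (E n (p ^ b) i).divisors)
      = (Finset.range (a + 1)).image (fun k => E n (p ^ k)) := by
    ext c
    simp only [Finset.mem_filter, Fintype.mem_piFinset, Finset.mem_image, Finset.mem_range]
    constructor
    · rintro ⟨h1, h2⟩
      have hc : c = E n (c ⟨0, by omega⟩) := by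
        funext i
        by_cases hi : i.val = 0
        · have : i = ⟨0, by omega⟩ := Fin.ext hi
          rw [this]
          simp [E]
        · have := h1 i
          simp [E, hi] at this
          simp [E, hi, this]
      rw [hc, prodE n _ hn] at h2
      obtain ⟨k, hk, hk2⟩ := (Nat.dvd_prime_pow hp).1 h2
      exact ⟨k, by omega, by rw [hc, hk2]⟩
    · rintro ⟨k, hk, rfl⟩
      refine ⟨fun i => ?_, ?_⟩
      · by_cases hi : i.val = 0
        · simp only [E, hi, if_true, Nat.mem_divisors]
          exact ⟨pow_dvd_pow p (by omega), (hpos b).ne'⟩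
        · simp [E, hi]
      · rw [prodE n _ hn]
        exact pow_dvd_pow p (by omega)
  rw [hset, Finset.sum_image]
  · refine Finset.sum_congr rfl fun k hk => ?_
    have hk' : k < a + 1 := Finset.mem_range.1 hk
    congr 1
    funext i
    rw [prodE n _ hn]
    by_cases hi : i.val = 0
    · simp only [E, hi, if_true]
      rw [Nat.pow_div (by omega) hp.pos, ← pow_add, Nat.pow_div (by omega) hp.pos]
      congr 1
      omega
    · by_cases hi1 : i.val = 1
      · simp [E, hi1]
      · have : i.val - 1 ≠ 0 := by omega
        simp [E, hi, hi1, this]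
  · intro x _ y _ hxy
    have := congrFun hxy ⟨0, by omega⟩
    simp only [E, if_true] at this
    exact Nat.pow_right_injective hp.two_le this

/-- Proposition 4.1:  Suppose `n ≥ 3`.  Let `p` be a prime and `j ∈ ℤ_{≥1}`.  Then
`A(1, p^j, 1, …, 1) = A(p^j,1,…,1)² - A(p^{j-1},1,…,1)·A(p^{j+1},1,…,1)`. -/
theorem statement14 (n : ℕ) (hn : 3 ≤ n) (A : (Fin (n - 1) → ℕ) → ℂ)
    (hA1 : A (fun _ => 1) = 1) (hA : HeckeRel n A)
    (p : ℕ) (hp : p.Prime) (j : ℕ) (hj : 1 ≤ j) :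
    A (fun i => if i.val = 1 then p ^ j else 1) =
      A (E n (p ^ j)) ^ 2 - A (E n (p ^ (j - 1))) * A (E n (p ^ (j + 1))) := by
  obtain ⟨l, rfl⟩ : ∃ l, j = l + 1 := ⟨j - 1, by omega⟩
  rw [sq, heckePow n hn A hA p hp _ _ le_rfl, heckePow n hn A hA p hp _ _ (by omega),
    Finset.sum_range_succ]
  have e1 : l + 1 - 1 + (l + 1 + 1) = l + 1 + (l + 1) := by omega
  have e2 : l + 1 - 1 + 1 = l + 1 := by omega
  rw [e1, e2, add_sub_cancel_left]
  congr 1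
  funext i
  by_cases hi : i.val = 0
  · have : l + 1 + (l + 1) - 2 * (l + 1) = 0 := by omega
    simp [hi, this]
  · simp [hi]
end
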